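/- arXiv:1711.10533 — 7 statements merged into one kernel-verified Lean document; each statement's English description precedes it below -/
import Mathlib

section
/- Entropy identity: for any smooth solution of the viscous sheet system with the stated boundary conditions and h > 0, the entropy S(t) = (1/2)∫₀¹ [h (v + ν h_x/h)² + σ h_x²] dx satisfies dS/dt + ν σ ∫₀¹ h_xx(x,t)² dx = 0 for every t > 0. -/
open MeasureTheory intervalIntegral

/-- The partial derivative in the first variable. -/
noncomputable def partialX (f : ℝ → ℝ → ℝ) (x t : ℝ) : ℝ := deriv (fun y => f y t) x

/-- The partial derivative in the second variable. -/
noncomputable def partialT (f : ℝ → ℝ → ℝ) (x t : ℝ) : ℝ := deriv (fun τ => f x τ) t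

section Partial

variable {f : ℝ → ℝ → ℝ}

lemma hasDerivAt_fst_fderiv (hf : ContDiff ℝ (⊤ : ℕ∞) (fun p : ℝ × ℝ => f p.1 p.2)) (x t : ℝ) :
    HasDerivAt (fun y => f y t) (fderiv ℝ (fun p : ℝ × ℝ => f p.1 p.2) (x, t) (1, 0)) x := by
  have hd := ((hf.differentiable (by simp)) (x, t)).hasFDerivAt
  exact hd.comp_hasDerivAt x ((hasDerivAt_id x).prodMk (hasDerivAt_const x t))

lemma hasDerivAt_snd_fderiv (hf : ContDiff ℝ (⊤ : ℕ∞) (fun p : ℝ × ℝ => f p.1 p.2)) (x t : ℝ) :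
    HasDerivAt (fun τ => f x τ) (fderiv ℝ (fun p : ℝ × ℝ => f p.1 p.2) (x, t) (0, 1)) t := by
  have hd := ((hf.differentiable (by simp)) (x, t)).hasFDerivAt
  exact hd.comp_hasDerivAt t ((hasDerivAt_const t x).prodMk (hasDerivAt_id t))

lemma hasDerivAt_partialX (hf : ContDiff ℝ (⊤ : ℕ∞) (fun p : ℝ × ℝ => f p.1 p.2)) (x t : ℝ) :
    HasDerivAt (fun y => f y t) (partialX f x t) x :=
  (hasDerivAt_fst_fderiv hf x t).differentiableAt.hasDerivAt

lemma hasDerivAt_partialT (hf : ContDiff ℝ (⊤ : ℕ∞) (fun p : ℝ × ℝ => f p.1 p.2)) (x t : ℝ) :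
    HasDerivAt (fun τ => f x τ) (partialT f x t) t :=
  (hasDerivAt_snd_fderiv hf x t).differentiableAt.hasDerivAt

lemma contDiff_fderiv_apply (hf : ContDiff ℝ (⊤ : ℕ∞) (fun p : ℝ × ℝ => f p.1 p.2)) (w : ℝ × ℝ) :
    ContDiff ℝ (⊤ : ℕ∞) (fun p : ℝ × ℝ => fderiv ℝ (fun q : ℝ × ℝ => f q.1 q.2) (p.1, p.2) w) :=
  (hf.fderiv_right (m := (⊤ : ℕ∞)) (by simp)).clm_apply contDiff_const

lemma partialX_eq_fderiv (hf : ContDiff ℝ (⊤ : ℕ∞) (fun p : ℝ × ℝ => f p.1 p.2)) :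
    partialX f = fun x t => fderiv ℝ (fun p : ℝ × ℝ => f p.1 p.2) (x, t) (1, 0) := by
  ext x t
  exact (hasDerivAt_fst_fderiv hf x t).deriv

lemma partialT_eq_fderiv (hf : ContDiff ℝ (⊤ : ℕ∞) (fun p : ℝ × ℝ => f p.1 p.2)) :
    partialT f = fun x t => fderiv ℝ (fun p : ℝ × ℝ => f p.1 p.2) (x, t) (0, 1) := by
  ext x t
  exact (hasDerivAt_snd_fderiv hf x t).deriv

lemma contDiff_partialX (hf : ContDiff ℝ (⊤ : ℕ∞) (fun p : ℝ × ℝ => f p.1 p.2)) :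
    ContDiff ℝ (⊤ : ℕ∞) (fun p : ℝ × ℝ => partialX f p.1 p.2) := by
  rw [partialX_eq_fderiv hf]
  exact contDiff_fderiv_apply hf _

lemma contDiff_partialT (hf : ContDiff ℝ (⊤ : ℕ∞) (fun p : ℝ × ℝ => f p.1 p.2)) :
    ContDiff ℝ (⊤ : ℕ∞) (fun p : ℝ × ℝ => partialT f p.1 p.2) := by
  rw [partialT_eq_fderiv hf]
  exact contDiff_fderiv_apply hf _

lemma partialT_partialX (hf : ContDiff ℝ (⊤ : ℕ∞) (fun p : ℝ × ℝ => f p.1 p.2)) (x t : ℝ) :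
    partialT (partialX f) x t = partialX (partialT f) x t := by
  have hd : DifferentiableAt ℝ (fderiv ℝ (fun p : ℝ × ℝ => f p.1 p.2)) (x, t) :=
    (hf.fderiv_right (m := (⊤ : ℕ∞)) (by simp)).differentiable (by simp) (x, t)
  have hsymm : IsSymmSndFDerivAt ℝ (fun p : ℝ × ℝ => f p.1 p.2) (x, t) :=
    hf.contDiffAt.isSymmSndFDerivAt (by
      simpa using WithTop.coe_le_coe.2 (le_top (a := (2 : ℕ∞))))
  have key (w w' : ℝ × ℝ) :
      fderiv ℝ (fun p : ℝ × ℝ => fderiv ℝ (fun q : ℝ × ℝ => f q.1 q.2) (p.1, p.2) w) (x, t) w' =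
        fderiv ℝ (fderiv ℝ (fun p : ℝ × ℝ => f p.1 p.2)) (x, t) w' w := by
    have := (hd.hasFDerivAt.clm_apply (hasFDerivAt_const w (x, t))).fderiv
    simp only [Prod.mk.eta]
    rw [this]
    simp
  rw [partialT_eq_fderiv (contDiff_partialX hf), partialX_eq_fderiv (contDiff_partialT hf)]
  simp only [partialX_eq_fderiv hf, partialT_eq_fderiv hf]
  rw [key, key]
  exact hsymm.eq _ _

/-- Differentiation under the integral sign for smooth integrands on a compact interval. -/
lemma hasDerivAt_integral_partialT (hf : ContDiff ℝ (⊤ : ℕ∞) (fun p : ℝ × ℝ => f p.1 p.2))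
    (a b t : ℝ) :
    HasDerivAt (fun τ => ∫ x in a..b, f x τ) (∫ x in a..b, partialT f x t) t := by
  have hf' := (contDiff_partialT hf).continuous
  have hcont (τ : ℝ) : Continuous (fun x => f x τ) :=
    hf.continuous.comp (continuous_id.prodMk continuous_const)
  have hcont' (τ : ℝ) : Continuous (fun x => partialT f x τ) :=
    hf'.comp (continuous_id.prodMk continuous_const)
  obtain ⟨C, hC⟩ := ((isCompact_uIcc (a := a) (b := b)).prod
    (isCompact_closedBall t 1)).exists_bound_of_continuousOn hf'.continuousOn
  refine (hasDerivAt_integral_of_dominated_loc_of_deriv_le (μ := volume)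
    (F := fun τ x => f x τ) (F' := fun τ x => partialT f x τ) (bound := fun _ => C)
    (Metric.closedBall_mem_nhds t one_pos) (.of_forall fun τ => (hcont τ).aestronglyMeasurable)
    ((hcont t).intervalIntegrable _ _) (hcont' t).aestronglyMeasurable
    (.of_forall fun x hx τ hτ => hC (x, τ) ⟨Set.uIoc_subset_uIcc hx, hτ⟩)
    (continuous_const.intervalIntegrable _ _)
    (.of_forall fun x _ τ _ => hasDerivAt_partialT hf x τ)).2

end Partial

/-- Entropy identity: for any smooth solution of the viscous sheet system
`v_t + v v_x = σ h_xxx + (ν/h)(h v_x)_x`, `h_t = −(h v)_x` on `(0,1) × (0,∞)`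
with boundary conditions `h_x(0,t) = h_x(1,t) = v(0,t) = v(1,t) = 0` and `h > 0`,
the entropy `S(t) = (1/2)∫₀¹ [h (v + ν h_x/h)² + σ h_x²] dx` satisfies
`dS/dt + ν σ ∫₀¹ h_xx² dx = 0` for every `t > 0`. -/
theorem entropy_identity
    (σ ν : ℝ) (hσ : 0 < σ) (hν : 0 < ν)
    (h v : ℝ → ℝ → ℝ)
    (hh : ContDiff ℝ (⊤ : ℕ∞) (fun p : ℝ × ℝ => h p.1 p.2))
    (hv : ContDiff ℝ (⊤ : ℕ∞) (fun p : ℝ × ℝ => v p.1 p.2))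
    (hpos : ∀ x t : ℝ, 0 < h x t)
    (momentum : ∀ x ∈ Set.Ioo (0:ℝ) 1, ∀ t : ℝ, 0 < t →
      deriv (fun τ => v x τ) t + v x t * deriv (fun y => v y t) x =
        σ * deriv (deriv (deriv (fun y => h y t))) x +
          (ν / h x t) * deriv (fun y => h y t * deriv (fun z => v z t) y) x)
    (continuity : ∀ x ∈ Set.Ioo (0:ℝ) 1, ∀ t : ℝ, 0 < t →
      deriv (fun τ => h x τ) t = - deriv (fun y => h y t * v y t) x)
    (bch : ∀ t : ℝ, 0 ≤ t →
      deriv (fun y => h y t) 0 = 0 ∧ deriv (fun y => h y t) 1 = 0)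
    (bcv : ∀ t : ℝ, 0 ≤ t → v 0 t = 0 ∧ v 1 t = 0) :
    ∀ t : ℝ, 0 < t →
      HasDerivAt
        (fun τ => (1/2) * ∫ x in (0:ℝ)..1,
          (h x τ * (v x τ + ν * deriv (fun y => h y τ) x / h x τ)^2
            + σ * (deriv (fun y => h y τ) x)^2))
        (-(ν * σ * ∫ x in (0:ℝ)..1, (deriv (deriv (fun y => h y t)) x)^2)) t := by
  intro t ht
  have hne (x t : ℝ) : h x t ≠ 0 := (hpos x t).ne'
  have hX := contDiff_partialX hh
  have hXX := contDiff_partialX hX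
  have hT := contDiff_partialT hh
  have vX := contDiff_partialX hv
  set w : ℝ → ℝ → ℝ := fun x τ => v x τ + ν * partialX h x τ / h x τ
  have hwsm : ContDiff ℝ (⊤ : ℕ∞) (fun p : ℝ × ℝ => w p.1 p.2) :=
    hv.add ((contDiff_const.mul hX).div hh fun p => hne _ _)
  set E : ℝ → ℝ → ℝ := fun x τ => h x τ * w x τ ^ 2 + σ * partialX h x τ ^ 2
  have hEsm : ContDiff ℝ (⊤ : ℕ∞) (fun p : ℝ × ℝ => E p.1 p.2) :=
    (hh.mul (hwsm.pow 2)).add (contDiff_const.mul (hX.pow 2))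
  set F : ℝ → ℝ → ℝ := fun x τ => -(1 / 2) * (h x τ * v x τ * w x τ ^ 2)
    + σ * (partialX h x τ * partialT h x τ) + σ * (h x τ * v x τ * partialX (partialX h) x τ)
    + ν * σ * (partialX h x τ * partialX (partialX h) x τ) with hF
  have hFsm : ContDiff ℝ (⊤ : ℕ∞) (fun p : ℝ × ℝ => F p.1 p.2) :=
    (((contDiff_const.mul ((hh.mul hv).mul (hwsm.pow 2))).add
      (contDiff_const.mul (hX.mul hT))).add (contDiff_const.mul ((hh.mul hv).mul hXX))).add
      (contDiff_const.mul (hX.mul hXX))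
  have slice {f : ℝ → ℝ → ℝ} (hf : ContDiff ℝ (⊤ : ℕ∞) (fun p : ℝ × ℝ => f p.1 p.2)) :
      Continuous (fun x => f x t) := hf.continuous.comp (continuous_id.prodMk continuous_const)
  have hflux : ∫ x in (0:ℝ)..1, partialX F x t = 0 := by
    rw [integral_eq_sub_of_hasDerivAt (fun x _ => hasDerivAt_partialX hFsm x t)
      ((slice (contDiff_partialX hFsm)).intervalIntegrable _ _)]
    have h0 : partialX h 0 t = 0 := (bch t ht.le).1
    have h1 : partialX h 1 t = 0 := (bch t ht.le).2
    simp [hF, h0, h1, (bcv t ht.le).1, (bcv t ht.le).2]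
  have hmass (x : ℝ) (hx : x ∈ Set.Ioo (0:ℝ) 1) :
      partialT h x t = -(partialX h x t * v x t + h x t * partialX v x t) :=
    (continuity x hx t ht).trans
      (congrArg _ ((hasDerivAt_partialX hh x t).mul (hasDerivAt_partialX hv x t)).deriv)
  have hlocal (x : ℝ) (hx : x ∈ Set.Ioo (0:ℝ) 1) :
      1 / 2 * partialT E x t = partialX F x t - ν * σ * partialX (partialX h) x t ^ 2 := by
    have dh := hasDerivAt_partialX hh x t
    have dv := hasDerivAt_partialX hv x t
    have dhx := hasDerivAt_partialX hX x t
    have dhxx := hasDerivAt_partialX hXX x t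
    have dvx := hasDerivAt_partialX vX x t
    have th := hasDerivAt_partialT hh x t
    have tv := hasDerivAt_partialT hv x t
    have thx := hasDerivAt_partialT hX x t
    have dht := hasDerivAt_partialX hT x t
    have hmassX : partialX (partialT h) x t =
        -((partialX (partialX h) x t * v x t + partialX h x t * partialX v x t) +
          (partialX h x t * partialX v x t + h x t * partialX (partialX v) x t)) :=
      (Filter.EventuallyEq.deriv_eq
        (Filter.eventually_of_mem (isOpen_Ioo.mem_nhds hx) hmass)).trans
        (((dhx.mul dv).add (dh.mul dvx)).neg).deriv
    have hmom : partialT v x t + v x t * partialX v x t =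
        σ * partialX (partialX (partialX h)) x t +
          (ν / h x t) * (partialX h x t * partialX v x t + h x t * partialX (partialX v) x t) :=
      (momentum x hx t ht).trans (congrArg (fun z => _ + (ν / h x t) * z) (dh.mul dvx).deriv)
    have dw := dv.add ((dhx.const_mul ν).div dh (hne x t))
    have tw := tv.add ((thx.const_mul ν).div th (hne x t))
    have hEt := ((th.mul (tw.pow 2)).add ((thx.pow 2).const_mul σ)).deriv
    have hFx := (((((dh.mul dv).mul (dw.pow 2)).const_mul (-(1 / 2))).add
      ((dhx.mul dht).const_mul σ)).add (((dh.mul dv).mul dhxx).const_mul σ)).add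
      ((dhx.mul dhxx).const_mul (ν * σ)) |>.deriv
    change partialT E x t = _ at hEt
    change partialX F x t = _ at hFx
    rw [hEt, hFx, partialT_partialX hh, hmassX, hmass x hx, eq_sub_of_add_eq hmom]
    simp only [Pi.add_apply, Pi.mul_apply, Pi.div_apply, Pi.pow_apply, Nat.add_one_sub_one, pow_one,
      Nat.cast_ofNat]
    have := hne x t
    field_simp
    ring
  have hcurv : Continuous (fun x => ν * σ * partialX (partialX h) x t ^ 2) :=
    continuous_const.mul ((slice hXX).pow 2)
  have hint : 1 / 2 * ∫ x in (0:ℝ)..1, partialT E x t =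
      -(ν * σ * ∫ x in (0:ℝ)..1, partialX (partialX h) x t ^ 2) := by
    rw [← intervalIntegral.integral_const_mul, integral_congr_Ioo_of_le zero_le_one hlocal,
      intervalIntegral.integral_sub ((slice (contDiff_partialX hFsm)).intervalIntegrable _ _)
        (hcurv.intervalIntegrable _ _),
      hflux, intervalIntegral.integral_const_mul, zero_sub]
  have hderiv := (hasDerivAt_integral_partialT hEsm 0 1 t).const_mul (1 / 2)
  rw [hint] at hderiv
  exact hderiv
end

section
/- Energy identity: for any smooth solution of the viscous sheet system with the stated boundary conditions and h > 0, the energy E(t) = (1/2)∫₀¹ [h v² + σ h_x²] dx satisfies dE/dt + ν ∫₀¹ h(x,t) v_x(x,t)² dx = 0 for every t > 0. -/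
open MeasureTheory intervalIntegral

open scoped ContDiff Topology

/-- The directional derivative of `f : ℝ × ℝ → ℝ` along the vector `w`. -/
noncomputable def dirDeriv (w : ℝ × ℝ) (f : ℝ × ℝ → ℝ) (p : ℝ × ℝ) : ℝ := fderiv ℝ f p w

theorem ContDiff.dirDeriv {f : ℝ × ℝ → ℝ} (hf : ContDiff ℝ ∞ f) (w : ℝ × ℝ) :
    ContDiff ℝ ∞ (dirDeriv w f) :=
  (hf.fderiv_right (m := ∞) (by simp)).clm_apply contDiff_const

theorem hasDerivAt_dirDeriv_fst {f : ℝ × ℝ → ℝ} (hf : ContDiff ℝ ∞ f) (x t : ℝ) :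
    HasDerivAt (fun y => f (y, t)) (dirDeriv (1, 0) f (x, t)) x :=
  (hf.differentiable (by simp) (x, t)).hasFDerivAt.comp_hasDerivAt x
    ((hasDerivAt_id x).prodMk (hasDerivAt_const x t))

theorem hasDerivAt_dirDeriv_snd {f : ℝ × ℝ → ℝ} (hf : ContDiff ℝ ∞ f) (x t : ℝ) :
    HasDerivAt (fun τ => f (x, τ)) (dirDeriv (0, 1) f (x, t)) t :=
  (hf.differentiable (by simp) (x, t)).hasFDerivAt.comp_hasDerivAt t
    ((hasDerivAt_const t x).prodMk (hasDerivAt_id t))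

theorem deriv_fst_eq_dirDeriv {f : ℝ × ℝ → ℝ} (hf : ContDiff ℝ ∞ f) (t : ℝ) :
    deriv (fun y => f (y, t)) = fun y => dirDeriv (1, 0) f (y, t) :=
  funext fun x => (hasDerivAt_dirDeriv_fst hf x t).deriv

theorem dirDeriv_comm {f : ℝ × ℝ → ℝ} (hf : ContDiff ℝ ∞ f) (u w : ℝ × ℝ) (p : ℝ × ℝ) :
    dirDeriv u (dirDeriv w f) p = dirDeriv w (dirDeriv u f) p := by
  have hd : DifferentiableAt ℝ (fderiv ℝ f) p :=
    (hf.fderiv_right (m := ∞) (by simp)).differentiable (by simp) p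
  have key (a b : ℝ × ℝ) : dirDeriv a (dirDeriv b f) p = fderiv ℝ (fderiv ℝ f) p a b := by
    have := (hd.hasFDerivAt.clm_apply (hasFDerivAt_const b p)).fderiv
    change fderiv ℝ (fun q => fderiv ℝ f q b) p a = _
    rw [this]
    simp
  rw [key, key]
  exact (hf.contDiffAt.isSymmSndFDerivAt (by
    simpa using WithTop.coe_le_coe.2 (le_top : (2 : ℕ∞) ≤ ⊤))).eq u w

/-- Differentiation of a smooth integrand under the integral sign. -/
theorem hasDerivAt_integral_of_contDiff {g : ℝ × ℝ → ℝ} (hg : ContDiff ℝ ∞ g) (a b t : ℝ) :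
    HasDerivAt (fun τ => ∫ x in a..b, g (x, τ)) (∫ x in a..b, dirDeriv (0, 1) g (x, t)) t := by
  have hcont (τ : ℝ) : Continuous fun x => g (x, τ) := by
    have := hg.continuous
    fun_prop
  have hcont' : Continuous (dirDeriv (0, 1) g) := (hg.dirDeriv _).continuous
  obtain ⟨C, hC⟩ := (isCompact_uIcc.prod (isCompact_closedBall t 1) :
    IsCompact (Set.uIcc a b ×ˢ Metric.closedBall t 1)).exists_bound_of_continuousOn
      hcont'.continuousOn
  refine (hasDerivAt_integral_of_dominated_loc_of_deriv_le
    (F := fun τ x => g (x, τ)) (F' := fun τ x => dirDeriv (0, 1) g (x, τ)) (bound := fun _ => C)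
    (Metric.closedBall_mem_nhds t one_pos) (.of_forall fun τ => (hcont τ).aestronglyMeasurable)
    ((hcont t).intervalIntegrable a b) ?_ ?_ intervalIntegrable_const ?_).2
  · exact (show Continuous fun x => dirDeriv (0, 1) g (x, t) by fun_prop).aestronglyMeasurable
  · exact .of_forall fun x hx τ hτ => hC (x, τ) ⟨Set.uIoc_subset_uIcc hx, hτ⟩
  · exact .of_forall fun x _ τ _ => hasDerivAt_dirDeriv_snd hg x τ

/-- Energy identity: for any smooth solution of the viscous sheet system
`v_t + v v_x = σ h_xxx + (ν/h)(h v_x)_x`, `h_t = −(h v)_x` on `(0,1) × (0,∞)`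
with boundary conditions `h_x(0,t) = h_x(1,t) = v(0,t) = v(1,t) = 0` and `h > 0`,
the energy `E(t) = (1/2)∫₀¹ [h v² + σ h_x²] dx` satisfies
`dE/dt + ν ∫₀¹ h v_x² dx = 0` for every `t > 0`. -/
theorem energy_identity
    (σ ν : ℝ) (hσ : 0 < σ) (hν : 0 < ν)
    (h v : ℝ → ℝ → ℝ)
    (hh : ContDiff ℝ (⊤ : ℕ∞) (fun p : ℝ × ℝ => h p.1 p.2))
    (hv : ContDiff ℝ (⊤ : ℕ∞) (fun p : ℝ × ℝ => v p.1 p.2))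
    (hpos : ∀ x t : ℝ, 0 < h x t)
    (momentum : ∀ x ∈ Set.Ioo (0:ℝ) 1, ∀ t : ℝ, 0 < t →
      deriv (fun τ => v x τ) t + v x t * deriv (fun y => v y t) x =
        σ * deriv (deriv (deriv (fun y => h y t))) x +
          (ν / h x t) * deriv (fun y => h y t * deriv (fun z => v z t) y) x)
    (continuity : ∀ x ∈ Set.Ioo (0:ℝ) 1, ∀ t : ℝ, 0 < t →
      deriv (fun τ => h x τ) t = - deriv (fun y => h y t * v y t) x)
    (bch : ∀ t : ℝ, 0 ≤ t →
      deriv (fun y => h y t) 0 = 0 ∧ deriv (fun y => h y t) 1 = 0)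
    (bcv : ∀ t : ℝ, 0 ≤ t → v 0 t = 0 ∧ v 1 t = 0) :
    ∀ t : ℝ, 0 < t →
      HasDerivAt
        (fun τ => (1/2) * ∫ x in (0:ℝ)..1,
          (h x τ * (v x τ)^2 + σ * (deriv (fun y => h y τ) x)^2))
        (-(ν * ∫ x in (0:ℝ)..1, h x t * (deriv (fun y => v y t) x)^2)) t := by
  intro t ht
  set H : ℝ × ℝ → ℝ := fun p => h p.1 p.2 with hH
  set V : ℝ × ℝ → ℝ := fun p => v p.1 p.2 with hV
  set Hx := dirDeriv (1, 0) H
  set Hxx := dirDeriv (1, 0) Hx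
  set Ht := dirDeriv (0, 1) H
  set Vx := dirDeriv (1, 0) V
  have cHx : ContDiff ℝ ∞ Hx := hh.dirDeriv _
  have cHxx : ContDiff ℝ ∞ Hxx := cHx.dirDeriv _
  have cHt : ContDiff ℝ ∞ Ht := hh.dirDeriv _
  have cVx : ContDiff ℝ ∞ Vx := hv.dirDeriv _
  have dh (τ : ℝ) : deriv (fun y => h y τ) = fun y => Hx (y, τ) := deriv_fst_eq_dirDeriv hh τ
  have dv (τ : ℝ) : deriv (fun y => v y τ) = fun y => Vx (y, τ) := deriv_fst_eq_dirDeriv hv τ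
  have Dh (x : ℝ) : HasDerivAt (fun y => h y t) (Hx (x, t)) x := hasDerivAt_dirDeriv_fst hh x t
  have Dv (x : ℝ) : HasDerivAt (fun y => v y t) (Vx (x, t)) x := hasDerivAt_dirDeriv_fst hv x t
  have DVx (x : ℝ) := hasDerivAt_dirDeriv_fst cVx x t
  have DHx (x : ℝ) := hasDerivAt_dirDeriv_fst cHx x t
  have DHxx (x : ℝ) := hasDerivAt_dirDeriv_fst cHxx x t
  have DHt (x : ℝ) := hasDerivAt_dirDeriv_fst cHt x t
  simp only [dh, dv] at momentum bch ⊢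
  let e : ℝ × ℝ → ℝ := fun p => H p * V p ^ 2 + σ * Hx p ^ 2
  have ce : ContDiff ℝ ∞ e := by fun_prop
  let flux : ℝ → ℝ := fun x => -(1 / 2) * (h x t * v x t ^ 3) + σ * (Hx (x, t) * Ht (x, t)) +
    σ * (h x t * v x t * Hxx (x, t)) + ν * (v x t * (h x t * Vx (x, t)))
  have flux_deriv (x : ℝ) := ((((Dh x).mul ((Dv x).pow 3)).const_mul (-(1 / 2))).add
    (((DHx x).mul (DHt x)).const_mul σ)).add ((((Dh x).mul (Dv x)).mul (DHxx x)).const_mul σ)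
    |>.add (((Dv x).mul ((Dh x).mul (DVx x))).const_mul ν)
  have energy_deriv (x : ℝ) : dirDeriv (0, 1) e (x, t) =
      Ht (x, t) * v x t ^ 2 + h x t * (2 * v x t * dirDeriv (0, 1) V (x, t)) +
        σ * (2 * Hx (x, t) * dirDeriv (1, 0) Ht (x, t)) := by
    rw [dirDeriv_comm hh (1, 0) (0, 1)]
    have := (((hasDerivAt_dirDeriv_snd hh x t).mul ((hasDerivAt_dirDeriv_snd hv x t).pow 2)).add
      (((hasDerivAt_dirDeriv_snd cHx x t).pow 2).const_mul σ))
    refine ((hasDerivAt_dirDeriv_snd ce x t).unique this).trans ?_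
    simp [hH, hV, Ht, Hx]
  have contDiss : Continuous fun x => h x t * Vx (x, t) ^ 2 := by
    have h1 := hh.continuous
    have h2 := cVx.continuous
    change Continuous fun x => H (x, t) * Vx (x, t) ^ 2
    fun_prop
  have contE : Continuous fun x => dirDeriv (0, 1) e (x, t) := by
    have := (ce.dirDeriv (0, 1)).continuous
    fun_prop
  have balance : ∫ x in (0 : ℝ)..1,
      ((1 / 2) * dirDeriv (0, 1) e (x, t) + ν * (h x t * Vx (x, t) ^ 2)) = flux 1 - flux 0 := by
    refine integral_eq_sub_of_hasDerivAt_of_le zero_le_one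
      (HasDerivAt.continuousOn fun x _ => flux_deriv x) (fun x hx => ?_)
      ((by fun_prop : Continuous _).intervalIntegrable _ _)
    refine (flux_deriv x).congr_deriv ?_
    have mom := momentum x hx t ht
    have mass := continuity x hx t ht
    rw [((Dh x).fun_mul (DVx x)).deriv, (hasDerivAt_dirDeriv_snd hv x t).deriv,
      deriv_fst_eq_dirDeriv cHx t, (DHxx x).deriv] at mom
    rw [((Dh x).fun_mul (Dv x)).deriv, (hasDerivAt_dirDeriv_snd hh x t).deriv] at mass
    change Ht (x, t) = _ at mass
    rw [energy_deriv]
    have hne := (hpos x t).ne'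
    field_simp at mom
    simp only [Pi.mul_apply, Pi.pow_apply]
    push_cast
    linear_combination (-v x t) * mom + (σ * Hxx (x, t) - v x t ^ 2 / 2) * mass
  obtain ⟨hx0, hx1⟩ := bch t ht.le
  obtain ⟨v0, v1⟩ := bcv t ht.le
  have flux_boundary : flux 1 - flux 0 = 0 := by simp [flux, hx0, hx1, v0, v1]
  rw [flux_boundary, integral_add ((contE.const_mul _).intervalIntegrable _ _)
    ((contDiss.const_mul _).intervalIntegrable _ _), intervalIntegral.integral_const_mul,
    intervalIntegral.integral_const_mul]
    at balance
  exact ((hasDerivAt_integral_of_contDiff ce 0 1 t).const_mul (1 / 2)).congr_deriv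
    (by linarith)
end

section
/- Wirtinger-type Poincaré inequality with Neumann conditions: if f : [0,1] → ℝ is twice continuously differentiable and f'(0) = f'(1) = 0, then ∫₀¹ f'(x)² dx ≤ (1/π²) ∫₀¹ f''(x)² dx. -/
open MeasureTheory intervalIntegral Real

/-- A non-sharp Wirtinger inequality, obtained by integrating the nonnegative function
`(g' + φ g)²` where `φ x = c tan (c (x - 1/2))` solves the Riccati equation `φ' = c² + φ²`. -/
lemma sq_mul_integral_sq_le_integral_deriv_sq {g : ℝ → ℝ} (hg : ContDiff ℝ 1 g)
    (hg0 : g 0 = 0) (hg1 : g 1 = 0) {c : ℝ} (hc0 : 0 < c) (hc : c < π) :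
    c ^ 2 * ∫ x in (0:ℝ)..1, g x ^ 2 ≤ ∫ x in (0:ℝ)..1, deriv g x ^ 2 := by
  have hg' : Continuous (deriv g) := hg.continuous_deriv_one
  have hcos : ∀ x ∈ Set.uIcc (0:ℝ) 1, cos (c * (x - 1 / 2)) ≠ 0 := by
    intro x hx
    rw [Set.uIcc_of_le zero_le_one] at hx
    exact (cos_pos_of_mem_Ioo ⟨by nlinarith [hx.1], by nlinarith [hx.2]⟩).ne'
  let φ : ℝ → ℝ := fun x => c * tan (c * (x - 1 / 2))
  let D : ℝ → ℝ := fun x => 2 * g x * deriv g x * φ x + g x ^ 2 * (c ^ 2 + φ x ^ 2)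
  have hφ : ∀ x ∈ Set.uIcc (0:ℝ) 1, HasDerivAt φ (c ^ 2 + φ x ^ 2) x := by
    intro x hx
    have hlin : HasDerivAt (fun y : ℝ => c * (y - 1 / 2)) (c * 1) x :=
      ((hasDerivAt_id x).sub_const _).const_mul c
    refine (((hasDerivAt_tan (hcos x hx)).comp x hlin).const_mul c).congr_deriv ?_
    rw [← inv_one_add_tan_sq (hcos x hx), one_div, inv_inv]
    simp only [φ]
    ring
  have hφc : ContinuousOn φ (Set.uIcc 0 1) := fun x hx =>
    (hφ x hx).continuousAt.continuousWithinAt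
  have hD : IntervalIntegrable D volume 0 1 := by
    have hgc := hg.continuous
    apply ContinuousOn.intervalIntegrable
    fun_prop
  have hDint : ∫ x in (0:ℝ)..1, D x = 0 := by
    have hderiv : ∀ x ∈ Set.uIcc (0:ℝ) 1, HasDerivAt (fun y => g y ^ 2 * φ y) (D x) x := by
      intro x hx
      refine (((hg.differentiable one_ne_zero x).hasDerivAt.pow 2).mul (hφ x hx)).congr_deriv ?_
      simp [D]
    rw [integral_eq_sub_of_hasDerivAt hderiv hD]
    simp [hg0, hg1]
  have hA : IntervalIntegrable (fun x => c ^ 2 * g x ^ 2) volume 0 1 :=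
    ((hg.continuous.pow 2).const_mul _).intervalIntegrable 0 1
  have hB : IntervalIntegrable (fun x => deriv g x ^ 2) volume 0 1 :=
    (hg'.pow 2).intervalIntegrable 0 1
  calc c ^ 2 * ∫ x in (0:ℝ)..1, g x ^ 2 = ∫ x in (0:ℝ)..1, c ^ 2 * g x ^ 2 := by
        rw [intervalIntegral.integral_const_mul]
    _ ≤ ∫ x in (0:ℝ)..1, (deriv g x ^ 2 + D x) := by
        refine intervalIntegral.integral_mono_on zero_le_one hA (hB.add hD) fun x _ => ?_
        simp only [D]
        nlinarith [sq_nonneg (deriv g x + φ x * g x)]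
    _ = ∫ x in (0:ℝ)..1, deriv g x ^ 2 := by
        rw [intervalIntegral.integral_add hB hD, hDint, add_zero]

/-- Wirtinger's inequality on `[0,1]` with Dirichlet boundary conditions. -/
lemma pi_sq_mul_integral_sq_le_integral_deriv_sq {g : ℝ → ℝ} (hg : ContDiff ℝ 1 g)
    (hg0 : g 0 = 0) (hg1 : g 1 = 0) :
    π ^ 2 * ∫ x in (0:ℝ)..1, g x ^ 2 ≤ ∫ x in (0:ℝ)..1, deriv g x ^ 2 := by
  have hlim : Filter.Tendsto (fun c : ℝ => c ^ 2 * ∫ x in (0:ℝ)..1, g x ^ 2)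
      (nhdsWithin π (Set.Iio π)) (nhds (π ^ 2 * ∫ x in (0:ℝ)..1, g x ^ 2)) :=
    ((continuous_id.pow 2).mul_const _).continuousWithinAt
  refine le_of_tendsto hlim ?_
  filter_upwards [Ioo_mem_nhdsLT pi_pos] with c hc
  exact sq_mul_integral_sq_le_integral_deriv_sq hg hg0 hg1 hc.1 hc.2

/-- Wirtinger-type Poincaré inequality with Neumann conditions: if `f` is twice
continuously differentiable on `[0,1]` with `f'(0) = f'(1) = 0`, then
`∫₀¹ f'(x)² dx ≤ (1/π²) ∫₀¹ f''(x)² dx`. -/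
theorem poincare_neumann
    (f : ℝ → ℝ) (hf : ContDiff ℝ 2 f)
    (hf0 : deriv f 0 = 0) (hf1 : deriv f 1 = 0) :
    ∫ x in (0:ℝ)..1, (deriv f x)^2 ≤
      (1/Real.pi^2) * ∫ x in (0:ℝ)..1, (deriv (deriv f) x)^2 := by
  have hg : ContDiff ℝ 1 (deriv f) := by
    have h : ContDiff ℝ (1 + 1) f := by rwa [one_add_one_eq_two]
    exact h.deriv'
  rw [one_div, ← div_eq_inv_mul, le_div_iff₀' (by positivity)]
  exact pi_sq_mul_integral_sq_le_integral_deriv_sq hg hf0 hf1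
end

section
/- Weighted interpolation estimate: let C₀ > 0 and E₀ > 0; let h : [0,1] → ℝ be C² with 0 ≤ h(x) ≤ C₀ for all x and h'(0) = h'(1) = 0, and let v : [0,1] → ℝ be C¹ with v(0) = v(1) = 0 and ∫₀¹ h v² dx ≤ E₀. Then for every p ∈ [1,∞] there exists a constant C_p, depending only on p, C₀ and E₀, such that ‖h^{3/2} v‖_{L^p(0,1)} ≤ C_p ( ‖√h · v'‖_{L²(0,1)} + ‖h''‖_{L²(0,1)} ). -/
open MeasureTheory intervalIntegral Real
open scoped ENNReal

instance isProbabilityMeasure_restrict_Ioo_zero_one :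
    IsProbabilityMeasure (volume.restrict (Set.Ioo (0 : ℝ) 1)) :=
  ⟨by simp⟩

/-- The one-dimensional Sobolev inequality `‖f‖_∞ ≤ ‖f'‖_{L¹}` for `f` vanishing at `0`. -/
theorem enorm_le_eLpNorm_deriv_of_contDiff {f : ℝ → ℝ} (hf : ContDiff ℝ 1 f) (h0 : f 0 = 0)
    {x : ℝ} (hx : x ∈ Set.Ioo (0 : ℝ) 1) :
    ‖f x‖ₑ ≤ eLpNorm (deriv f) 1 (volume.restrict (Set.Ioo (0 : ℝ) 1)) := by
  have key := enorm_sub_le_lintegral_deriv_of_contDiffOn_Icc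
    (hf.contDiffOn (s := Set.Icc 0 x)) hx.1.le
  rw [h0, sub_zero, ← restrict_Ioo_eq_restrict_Icc] at key
  rw [eLpNorm_one_eq_lintegral_enorm]
  exact key.trans (lintegral_mono_set (Set.Ioo_subset_Ioo_right hx.2.le))

/-- A bound on `∫₀¹ h v²` is a bound on the `L²` norm of `√h v`. -/
theorem eLpNorm_sqrt_mul_le {h v : ℝ → ℝ} {E : ℝ} (hh : Continuous h) (hv : Continuous v)
    (hnonneg : ∀ x ∈ Set.Icc (0 : ℝ) 1, 0 ≤ h x)
    (hE : ∫ x in (0 : ℝ)..1, h x * v x ^ 2 ≤ E) :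
    eLpNorm (fun x => √(h x) * v x) 2 (volume.restrict (Set.Ioo (0 : ℝ) 1)) ≤
      ENNReal.ofReal (√E) := by
  have hsq : eLpNorm (fun x => √(h x) * v x) 2 (volume.restrict (Set.Ioo (0 : ℝ) 1)) ^ (2 : ℝ) =
      ENNReal.ofReal (∫ x in (0 : ℝ)..1, h x * v x ^ 2) := by
    have hpow := eLpNorm_nnreal_pow_eq_lintegral (p := 2) (f := fun x => √(h x) * v x)
      (μ := volume.restrict (Set.Ioo (0 : ℝ) 1)) two_ne_zero
    norm_num at hpow
    rw [integral_of_le zero_le_one, integral_Ioc_eq_integral_Ioo,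
      ofReal_integral_eq_lintegral_ofReal]
    · norm_num
      rw [hpow]
      refine setLIntegral_congr_fun measurableSet_Ioo fun x hx => ?_
      have hx0 := hnonneg x (Set.Ioo_subset_Icc_self hx)
      simp only [Real.enorm_eq_ofReal_abs]
      rw [← ENNReal.ofReal_mul (abs_nonneg _), ← ENNReal.ofReal_pow (by positivity)]
      congr 1
      rw [mul_pow, sq_abs, sq_abs, Real.sq_sqrt hx0]
    · exact ((by fun_prop : Continuous fun x => h x * v x ^ 2).integrableOn_Icc).mono_set
        Set.Ioo_subset_Icc_self
    · filter_upwards [self_mem_ae_restrict measurableSet_Ioo] with x hx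
      exact mul_nonneg (hnonneg x (Set.Ioo_subset_Icc_self hx)) (sq_nonneg _)
  have hint : 0 ≤ ∫ x in (0 : ℝ)..1, h x * v x ^ 2 :=
    intervalIntegral.integral_nonneg zero_le_one fun x hx =>
      mul_nonneg (hnonneg x hx) (sq_nonneg _)
  rw [← ENNReal.rpow_le_rpow_iff (z := 2) two_pos, hsq,
    ENNReal.ofReal_rpow_of_nonneg (Real.sqrt_nonneg _) zero_le_two, Real.rpow_two,
    Real.sq_sqrt (hint.trans hE)]
  exact ENNReal.ofReal_le_ofReal hE

theorem deriv_rpow_three_halves_mul {h v : ℝ → ℝ} {x : ℝ} (hh : DifferentiableAt ℝ h x)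
    (hv : DifferentiableAt ℝ v x) (hx : 0 ≤ h x) :
    deriv (fun y => h y ^ (3 / 2 : ℝ) * v y) x =
      h x * (√(h x) * deriv v x) + 3 / 2 * deriv h x * (√(h x) * v x) := by
  rw [((hh.hasDerivAt.rpow_const (p := 3 / 2) (Or.inr (by norm_num))).fun_mul hv.hasDerivAt).deriv]
  have h1 : h x ^ (3 / 2 : ℝ) = h x * √(h x) := by
    rw [Real.sqrt_eq_rpow, show (3 / 2 : ℝ) = 1 + 1 / 2 by norm_num,
      Real.rpow_add_of_nonneg hx (by norm_num) (by norm_num), Real.rpow_one]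
  have h2 : h x ^ (3 / 2 - 1 : ℝ) = √(h x) := by
    rw [Real.sqrt_eq_rpow]; norm_num
  rw [h1, h2]
  ring

/-- Weighted interpolation estimate: for `0 ≤ h ≤ C₀` with Neumann boundary
conditions and `v` vanishing at the endpoints with `∫₀¹ h v² ≤ E₀`, for every
`p ∈ [1,∞]` there is a constant `C_p` depending only on `p, C₀, E₀` with
`‖h^{3/2} v‖_{L^p(0,1)} ≤ C_p (‖√h · v'‖_{L²(0,1)} + ‖h''‖_{L²(0,1)})`. -/
theorem weighted_interpolation_estimate
    (C₀ E₀ : ℝ) (hC₀ : 0 < C₀) (hE₀ : 0 < E₀) (p : ℝ≥0∞) (hp : 1 ≤ p) :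
    ∃ C : ℝ, 0 < C ∧ ∀ h v : ℝ → ℝ,
      ContDiff ℝ 2 h →
      (∀ x ∈ Set.Icc (0:ℝ) 1, 0 ≤ h x ∧ h x ≤ C₀) →
      deriv h 0 = 0 → deriv h 1 = 0 →
      ContDiff ℝ 1 v → v 0 = 0 → v 1 = 0 →
      (∫ x in (0:ℝ)..1, h x * (v x)^2) ≤ E₀ →
      eLpNorm (fun x => h x ^ (3/2 : ℝ) * v x) p
          (volume.restrict (Set.Ioo (0:ℝ) 1)) ≤
        ENNReal.ofReal C *
          (eLpNorm (fun x => Real.sqrt (h x) * deriv v x) 2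
              (volume.restrict (Set.Ioo (0:ℝ) 1)) +
            eLpNorm (fun x => deriv (deriv h) x) 2
              (volume.restrict (Set.Ioo (0:ℝ) 1))) := by
  set μ := volume.restrict (Set.Ioo (0 : ℝ) 1) with hμ
  refine ⟨C₀ + 3 / 2 * √E₀, by positivity, fun h v hh hbound hh0 _ hv hv0 _ hE => ?_⟩
  have hdh : ContDiff ℝ 1 (deriv h) := (contDiff_succ_iff_deriv.1 hh).2.2
  have hddhc : Continuous (deriv (deriv h)) := hdh.continuous_deriv_one
  have hdvc : Continuous (deriv v) := hv.continuous_deriv_one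
  have hhc := hh.continuous
  have hdhc := hdh.continuous
  have hvc := hv.continuous
  have hh1 : ContDiff ℝ 1 h := hh.of_le (by norm_num)
  set A := eLpNorm (fun x => √(h x) * deriv v x) 2 μ
  set B := eLpNorm (fun x => deriv (deriv h) x) 2 μ
  have hB {x : ℝ} (hx : x ∈ Set.Ioo (0 : ℝ) 1) : ‖deriv h x‖ₑ ≤ B :=
    (enorm_le_eLpNorm_deriv_of_contDiff hdh hh0 hx).trans
      (eLpNorm_le_eLpNorm_of_exponent_le one_le_two hddhc.aestronglyMeasurable)
  have hfirst : eLpNorm (fun x => h x * (√(h x) * deriv v x)) 1 μ ≤ ENNReal.ofReal C₀ * A := by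
    refine (eLpNorm_le_mul_eLpNorm_of_ae_le_mul (g := fun x => √(h x) * deriv v x) (c := C₀)
      ?_ 1).trans ?_
    · filter_upwards [self_mem_ae_restrict measurableSet_Ioo] with x hx
      obtain ⟨hx0, hx1⟩ := hbound x (Set.Ioo_subset_Icc_self hx)
      rw [norm_mul, Real.norm_of_nonneg hx0]
      gcongr
    · gcongr
      exact eLpNorm_le_eLpNorm_of_exponent_le one_le_two
        (by fun_prop : Continuous fun x => √(h x) * deriv v x).aestronglyMeasurable
  have hsecond : eLpNorm (fun x => 3 / 2 * deriv h x * (√(h x) * v x)) 1 μ ≤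
      ENNReal.ofReal (3 / 2 * √E₀) * B := by
    have hmeas : AEStronglyMeasurable (fun x => √(h x) * v x) μ :=
      (by fun_prop : Continuous fun x => √(h x) * v x).aestronglyMeasurable
    refine (eLpNorm_le_mul_eLpNorm_of_ae_le_mul'' (g := fun x => √(h x) * v x)
      (c := ENNReal.ofReal (3 / 2) * B) 1 hmeas ?_).trans ?_
    · filter_upwards [self_mem_ae_restrict measurableSet_Ioo] with x hx
      rw [enorm_mul, enorm_mul, Real.enorm_of_nonneg (by norm_num : (0 : ℝ) ≤ 3 / 2)]
      gcongr
      exact hB hx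
    · rw [ENNReal.ofReal_mul (by norm_num), mul_right_comm (ENNReal.ofReal (3 / 2))]
      gcongr
      exact (eLpNorm_le_eLpNorm_of_exponent_le one_le_two hmeas).trans
        (eLpNorm_sqrt_mul_le hhc hvc (fun x hx => (hbound x hx).1) hE)
  have hw : ContDiff ℝ 1 (fun x => h x ^ (3 / 2 : ℝ) * v x) :=
    (ContDiff.rpow_const_of_le (m := 1) (by exact_mod_cast hh1) (by norm_num)).mul hv
  have hdw : eLpNorm (deriv fun x => h x ^ (3 / 2 : ℝ) * v x) 1 μ ≤
      ENNReal.ofReal (C₀ + 3 / 2 * √E₀) * (A + B) := calc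
    _ = eLpNorm ((fun x => h x * (√(h x) * deriv v x)) +
          fun x => 3 / 2 * deriv h x * (√(h x) * v x)) 1 μ := by
      refine eLpNorm_congr_ae ?_
      filter_upwards [self_mem_ae_restrict measurableSet_Ioo] with x hx
      exact deriv_rpow_three_halves_mul (hh1.differentiable one_ne_zero x)
        (hv.differentiable one_ne_zero x) (hbound x (Set.Ioo_subset_Icc_self hx)).1
    _ ≤ ENNReal.ofReal C₀ * A + ENNReal.ofReal (3 / 2 * √E₀) * B :=
      (eLpNorm_add_le (by fun_prop : Continuous _).aestronglyMeasurable
        (by fun_prop : Continuous _).aestronglyMeasurable le_rfl).trans (add_le_add hfirst hsecond)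
    _ ≤ ENNReal.ofReal (C₀ + 3 / 2 * √E₀) * A + ENNReal.ofReal (C₀ + 3 / 2 * √E₀) * B := by
      gcongr
      · exact le_add_of_nonneg_right (by positivity)
      · exact le_add_of_nonneg_left hC₀.le
    _ = _ := (mul_add _ _ _).symm
  refine (eLpNorm_le_of_ae_enorm_bound (C := ENNReal.ofReal (C₀ + 3 / 2 * √E₀) * (A + B))
    ?_).trans (by simp [hμ])
  filter_upwards [self_mem_ae_restrict measurableSet_Ioo] with x hx
  exact (enorm_le_eLpNorm_deriv_of_contDiff hw (by simp [hv0]) hx).trans hdw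
end

section
/- Exponential L² decay to the flat profile for the super-fast-diffusion-type equation without forcing: let u be a positive classical solution of u_t = ν (u^{-2} u_s)_s on (0,1) × (0,∞) with Neumann boundary conditions u_s(0,t) = u_s(1,t) = 0, initial data u₀ satisfying ∫₀¹ u₀(s) ds = 1 and ‖u₀‖_∞ > 1. Then ∫₀¹ (u(s,t) − 1)² ds ≤ A e^{−B t} for all t ≥ 0, where A = ∫₀¹ (u₀(s) − 1)² ds and B = 2ν (ln‖u₀‖_∞ / (‖u₀‖_∞ − 1))². -/
open MeasureTheory intervalIntegral Real

/-- Differentiation under the integral sign for a jointly continuous partial derivative. -/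
theorem hasDerivAt_intervalIntegral_of_continuous {G G' : ℝ → ℝ → ℝ}
    (hG : Continuous fun p : ℝ × ℝ => G p.1 p.2) (hG' : Continuous fun p : ℝ × ℝ => G' p.1 p.2)
    (hd : ∀ s t, HasDerivAt (G s) (G' s t) t) (a b t : ℝ) :
    HasDerivAt (fun τ => ∫ s in a..b, G s τ) (∫ s in a..b, G' s t) t := by
  obtain ⟨C, hC⟩ := (isCompact_uIcc (a := a) (b := b)).prod
    (isCompact_Icc (a := t - 1) (b := t + 1)) |>.exists_bound_of_continuousOn hG'.continuousOn
  have hGc (τ : ℝ) : Continuous fun s => G s τ := hG.comp (by fun_prop : Continuous fun s => (s, τ))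
  have hGc' (τ : ℝ) : Continuous fun s => G' s τ :=
    hG'.comp (by fun_prop : Continuous fun s => (s, τ))
  refine (intervalIntegral.hasDerivAt_integral_of_dominated_loc_of_deriv_le
    (F := fun τ s => G s τ) (F' := fun τ s => G' s τ) (bound := fun _ => C)
    (s := Set.Icc (t - 1) (t + 1)) (Icc_mem_nhds (by linarith) (by linarith))
    (Filter.Eventually.of_forall fun τ => (hGc τ).aestronglyMeasurable)
    ((hGc t).intervalIntegrable _ _) (hGc' t).aestronglyMeasurable
    (Filter.Eventually.of_forall fun s hs τ hτ => ?_) intervalIntegrable_const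
    (Filter.Eventually.of_forall fun s _ τ _ => hd s τ)).2
  exact hC (s, τ) ⟨Set.uIoc_subset_uIcc hs, hτ⟩

/-- Powers of the positive part of exponent at least two are differentiable. -/
theorem hasDerivAt_max_sub_zero_pow (c : ℝ) (n : ℕ) (x : ℝ) :
    HasDerivAt (fun y => max (y - c) 0 ^ (n + 2)) ((n + 2) * max (x - c) 0 ^ (n + 1)) x := by
  have hpow (x : ℝ) : HasDerivAt (fun y => (y - c) ^ (n + 2)) ((n + 2) * (x - c) ^ (n + 1)) x := by
    simpa using ((hasDerivAt_id x).sub_const c).fun_pow (n + 2)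
  rcases lt_trichotomy x c with h | rfl | h
  · rw [max_eq_right (by linarith)]
    simp only [ne_eq, Nat.add_eq_zero_iff, one_ne_zero, and_false, not_false_eq_true, zero_pow,
      mul_zero]
    refine (hasDerivAt_const x (0 : ℝ)).congr_of_eventuallyEq ?_
    filter_upwards [Iio_mem_nhds h] with y hy
    rw [max_eq_right (by linarith [Set.mem_Iio.1 hy])]
    simp
  · have hl : HasDerivWithinAt (fun y => max (y - x) 0 ^ (n + 2)) 0 (Set.Iic x) x := by
      refine (hasDerivWithinAt_const x _ (0 : ℝ)).congr (fun y hy => ?_) (by simp)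
      rw [max_eq_right (by linarith [Set.mem_Iic.1 hy])]
      simp
    have hr : HasDerivWithinAt (fun y => max (y - x) 0 ^ (n + 2)) 0 (Set.Ici x) x := by
      have h0 := (hpow x).hasDerivWithinAt (s := Set.Ici x)
      simp only [sub_self, ne_eq, Nat.add_eq_zero_iff, one_ne_zero, and_false, not_false_eq_true,
        zero_pow, mul_zero] at h0
      refine h0.congr (fun y hy => ?_) (by simp)
      rw [max_eq_left (by linarith [Set.mem_Ici.1 hy])]
    simpa [Set.Iic_union_Ici] using hl.union hr
  · rw [max_eq_left (by linarith)]
    refine (hpow x).congr_of_eventuallyEq ?_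
    filter_upwards [Ioi_mem_nhds h] with y hy
    rw [max_eq_left (by linarith [Set.mem_Ioi.1 hy])]

theorem sq_integral_le_integral_sq {g : ℝ → ℝ} (hg : Continuous g) {a b : ℝ} (hab : a ≤ b)
    (hb : b - a ≤ 1) : (∫ s in a..b, g s) ^ 2 ≤ ∫ s in a..b, g s ^ 2 := by
  set c := ∫ s in a..b, g s with hc
  have h0 : 0 ≤ ∫ s in a..b, (g s - c) ^ 2 :=
    intervalIntegral.integral_nonneg hab fun s _ => sq_nonneg _
  have h1 : ∫ s in a..b, (g s - c) ^ 2
      = (∫ s in a..b, g s ^ 2) - 2 * c * c + (b - a) * c ^ 2 := by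
    have : ∀ s, (g s - c) ^ 2 = g s ^ 2 - 2 * c * g s + c ^ 2 := fun s => by ring
    simp_rw [this]
    rw [intervalIntegral.integral_add (Continuous.intervalIntegrable (by fun_prop) _ _)
        (Continuous.intervalIntegrable (by fun_prop) _ _),
      intervalIntegral.integral_sub (Continuous.intervalIntegrable (by fun_prop) _ _)
        (Continuous.intervalIntegrable (by fun_prop) _ _),
      intervalIntegral.integral_const_mul, intervalIntegral.integral_const, ← hc, smul_eq_mul]
  nlinarith [mul_nonneg (sub_nonneg.2 hb) (sq_nonneg c)]

/-- A `C¹` function vanishing somewhere in the unit interval is bounded there by the `L²` norm of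
its derivative. -/
theorem sq_le_integral_deriv_sq {w g : ℝ → ℝ} (hw : ∀ s, HasDerivAt w (g s) s) (hg : Continuous g)
    {r s : ℝ} (hr : r ∈ Set.Icc (0 : ℝ) 1) (hs : s ∈ Set.Icc (0 : ℝ) 1) (h0 : w r = 0) :
    w s ^ 2 ≤ ∫ x in (0 : ℝ)..1, g x ^ 2 := by
  have key {a b : ℝ} (ha : 0 ≤ a) (hab : a ≤ b) (hb : b ≤ 1) :
      (w b - w a) ^ 2 ≤ ∫ x in (0 : ℝ)..1, g x ^ 2 := by
    rw [← intervalIntegral.integral_eq_sub_of_hasDerivAt (fun x _ => hw x)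
      (hg.intervalIntegrable _ _)]
    refine (sq_integral_le_integral_sq hg hab (by linarith)).trans ?_
    exact intervalIntegral.integral_mono_interval ha hab hb
      (Filter.Eventually.of_forall fun x => sq_nonneg _)
      (Continuous.intervalIntegrable (by fun_prop) _ _)
  rcases le_total r s with h | h
  · simpa [h0] using key hr.1 h hs.2
  · simpa [h0] using key hs.1 h hr.2

theorem sq_sub_one_mul_le_sq_log {U x : ℝ} (hU : 1 < U) (hx : 0 < x) (hxU : x ≤ U) :
    (log U / (U - 1)) ^ 2 * (x - 1) ^ 2 ≤ log x ^ 2 := by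
  have hU1 : 0 < U - 1 := by linarith
  have hlog : 0 < log U := log_pos hU
  rw [← mul_pow, sq_le_sq]
  rcases le_total x 1 with h | h
  · have h1 : log U / (U - 1) ≤ 1 := by
      rw [div_le_one hU1]; exact log_le_sub_one_of_pos (by linarith)
    have h2 := log_le_sub_one_of_pos hx
    rw [abs_of_nonpos (mul_nonpos_of_nonneg_of_nonpos (by positivity) (by linarith)),
      abs_of_nonpos (by linarith)]
    nlinarith
  · have hx1 : 0 ≤ log x := log_nonneg h
    rw [abs_of_nonneg (mul_nonneg (by positivity) (by linarith)), abs_of_nonneg hx1]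
    have hc := strictConcaveOn_log_Ioi.concaveOn.right (Set.mem_Ioi.2 one_pos)
      (Set.mem_Ioi.2 (by linarith : 0 < U))
      (div_nonneg (by linarith : 0 ≤ U - x) hU1.le) (div_nonneg (by linarith : 0 ≤ x - 1) hU1.le)
      (by field_simp; ring)
    simp only [smul_eq_mul, log_one, mul_zero, zero_add] at hc
    have he : (U - x) / (U - 1) * 1 + (x - 1) / (U - 1) * U = x := by field_simp; ring
    rw [he] at hc
    calc log U / (U - 1) * (x - 1) = (x - 1) / (U - 1) * log U := by ring
      _ ≤ log x := hc

/-- Evolution of `∫ φ(u)` along the flow: only the dissipation of `φ` survives. -/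
theorem hasDerivAt_integral_comp_superfast {ν : ℝ} {u : ℝ → ℝ → ℝ}
    (hu : ContDiff ℝ (⊤ : ℕ∞) (fun p : ℝ × ℝ => u p.1 p.2))
    (hupos : ∀ s t : ℝ, 0 < u s t)
    (pde : ∀ s ∈ Set.Ioo (0:ℝ) 1, ∀ t : ℝ, 0 < t →
      deriv (fun τ => u s τ) t =
        ν * deriv (fun y => deriv (fun z => u z t) y / (u y t)^2) s)
    (bc : ∀ t : ℝ, 0 ≤ t →
      deriv (fun y => u y t) 0 = 0 ∧ deriv (fun y => u y t) 1 = 0)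
    {φ φ' φ'' : ℝ → ℝ} (hφ : ∀ x, HasDerivAt φ (φ' x) x) (hφ' : ∀ x, HasDerivAt φ' (φ'' x) x)
    (hφ'' : Continuous φ'') :
    (∀ t, DifferentiableAt ℝ (fun τ => ∫ s in (0:ℝ)..1, φ (u s τ)) t) ∧
    ∀ t, 0 < t → HasDerivAt (fun τ => ∫ s in (0:ℝ)..1, φ (u s τ))
      (-(ν * ∫ s in (0:ℝ)..1, φ'' (u s t) * (deriv (fun z => u z t) s / u s t) ^ 2)) t := by
  have hc : Continuous fun p : ℝ × ℝ => u p.1 p.2 := hu.continuous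
  have hus (t : ℝ) : ContDiff ℝ (⊤ : ℕ∞) (fun z => u z t) :=
    hu.comp (contDiff_id.prodMk contDiff_const)
  have hut (s t : ℝ) : HasDerivAt (fun τ => u s τ)
      (fderiv ℝ (fun p : ℝ × ℝ => u p.1 p.2) (s, t) (0, 1)) t := by
    have h1 : HasDerivAt (fun τ : ℝ => (s, τ)) ((0 : ℝ), (1 : ℝ)) t :=
      (hasDerivAt_const t s).prodMk (hasDerivAt_id t)
    exact ((hu.differentiable (by simp)) (s, t)).hasFDerivAt.comp_hasDerivAt t h1
  have hDt : Continuous fun p : ℝ × ℝ => fderiv ℝ (fun p : ℝ × ℝ => u p.1 p.2) p (0, 1) :=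
    (hu.continuous_fderiv (by simp)).clm_apply continuous_const
  have hφc : Continuous φ := continuous_iff_continuousAt.2 fun x => (hφ x).continuousAt
  have hφc' : Continuous φ' := continuous_iff_continuousAt.2 fun x => (hφ' x).continuousAt
  have hder (t : ℝ) := hasDerivAt_intervalIntegral_of_continuous (G := fun s τ => φ (u s τ))
    (G' := fun s τ => φ' (u s τ) * fderiv ℝ (fun p : ℝ × ℝ => u p.1 p.2) (s, τ) (0, 1))
    (hφc.comp hc) ((hφc'.comp hc).mul hDt) (fun s τ => (hφ (u s τ)).comp τ (hut s τ)) 0 1 t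
  refine ⟨fun t => (hder t).differentiableAt, fun t ht => ?_⟩
  convert hder t using 1
  set v : ℝ → ℝ := fun y => deriv (fun z => u z t) y / (u y t) ^ 2 with hv
  have hd : ContDiff ℝ (⊤ : ℕ∞) (deriv fun z => u z t) :=
    (contDiff_infty_iff_deriv.1 (hus t)).2
  have hvs : ContDiff ℝ (⊤ : ℕ∞) v :=
    hd.div ((hus t).pow 2) fun y => pow_ne_zero 2 (hupos y t).ne'
  have hud (s : ℝ) : HasDerivAt (fun z => u z t) (deriv (fun z => u z t) s) s :=
    ((hus t).differentiable (by simp) s).hasDerivAt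
  have hibp := intervalIntegral.integral_mul_deriv_eq_deriv_mul (a := 0) (b := 1)
    (u := fun s => φ' (u s t)) (v := v) (u' := fun s => φ'' (u s t) * deriv (fun z => u z t) s)
    (v' := deriv v) (fun s _ => (hφ' (u s t)).comp s (hud s))
    (fun s _ => (hvs.differentiable (by simp) s).hasDerivAt)
    (((hφ''.comp (hus t).continuous).mul hd.continuous).intervalIntegrable _ _)
    ((hvs.continuous_deriv (by simp)).intervalIntegrable _ _)
  have hv0 : v 0 = 0 := by simp [hv, (bc t ht.le).1]
  have hv1 : v 1 = 0 := by simp [hv, (bc t ht.le).2]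
  have hrhs : ∫ s in (0:ℝ)..1, φ' (u s t) * fderiv ℝ (fun p : ℝ × ℝ => u p.1 p.2) (s, t) (0, 1)
      = ∫ s in (0:ℝ)..1, ν * (φ' (u s t) * deriv v s) := by
    refine intervalIntegral.integral_congr_Ioo_of_le zero_le_one fun s hs => ?_
    rw [← (hut s t).deriv, pde s hs t ht]
    ring
  rw [hrhs, intervalIntegral.integral_const_mul, hibp, hv0, hv1]
  have hlhs : ∫ s in (0:ℝ)..1, φ'' (u s t) * (deriv (fun z => u z t) s / u s t) ^ 2
      = ∫ s in (0:ℝ)..1, φ'' (u s t) * deriv (fun z => u z t) s * v s :=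
    intervalIntegral.integral_congr fun s _ => by
      simp only [hv]
      have := (hupos s t).ne'
      field_simp
  rw [hlhs]
  ring

/-- Exponential L² decay to the flat profile for the super-fast-diffusion-type
equation without forcing `u_t = ν (u^{-2} u_s)_s`: with `∫₀¹ u₀ = 1` and
`‖u₀‖_∞ > 1`, one has `∫₀¹ (u(s,t) − 1)² ds ≤ A e^{−B t}` for all `t ≥ 0`,
where `A = ∫₀¹ (u₀ − 1)² ds` and `B = 2ν (ln‖u₀‖_∞/(‖u₀‖_∞ − 1))²`. -/
theorem superfast_diffusion_L2_exponential_decay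
    (ν : ℝ) (hν : 0 < ν)
    (u : ℝ → ℝ → ℝ)
    (hu : ContDiff ℝ (⊤ : ℕ∞) (fun p : ℝ × ℝ => u p.1 p.2))
    (hupos : ∀ s t : ℝ, 0 < u s t)
    (pde : ∀ s ∈ Set.Ioo (0:ℝ) 1, ∀ t : ℝ, 0 < t →
      deriv (fun τ => u s τ) t =
        ν * deriv (fun y => deriv (fun z => u z t) y / (u y t)^2) s)
    (bc : ∀ t : ℝ, 0 ≤ t →
      deriv (fun y => u y t) 0 = 0 ∧ deriv (fun y => u y t) 1 = 0)
    (hmass : ∫ s in (0:ℝ)..1, u s 0 = 1)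
    (U₀ : ℝ) (hU₀ : U₀ = sSup ((fun s => u s 0) '' Set.Icc (0:ℝ) 1))
    (hU₀gt : 1 < U₀) :
    ∀ t : ℝ, 0 ≤ t →
      ∫ s in (0:ℝ)..1, (u s t - 1)^2 ≤
        (∫ s in (0:ℝ)..1, (u s 0 - 1)^2) *
          Real.exp (-(2 * ν * (Real.log U₀ / (U₀ - 1))^2) * t) := by
  have hus (t : ℝ) : ContDiff ℝ (⊤ : ℕ∞) (fun z => u z t) :=
    hu.comp (contDiff_id.prodMk contDiff_const)
  have hucont (t : ℝ) : Continuous fun s => u s t := (hus t).continuous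
  have hU (s : ℝ) (hs : s ∈ Set.Icc (0:ℝ) 1) : u s 0 ≤ U₀ := by
    rw [hU₀]
    exact le_csSup (isCompact_Icc.image (hucont 0)).bddAbove ⟨s, hs, rfl⟩
  have hmassT (t : ℝ) (ht : 0 ≤ t) : ∫ s in (0:ℝ)..1, u s t = 1 := by
    obtain ⟨hdiff, hder⟩ := hasDerivAt_integral_comp_superfast hu hupos pde bc
      (φ := fun x => x) (φ' := fun _ => 1) (φ'' := fun _ => 0) hasDerivAt_id
      (fun x => hasDerivAt_const x 1) continuous_const
    rcases ht.eq_or_lt with rfl | ht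
    · exact hmass
    obtain ⟨c, hc, hslope⟩ := exists_deriv_eq_slope _ ht
      (fun x _ => (hdiff x).continuousAt.continuousWithinAt)
      (fun x _ => (hdiff x).differentiableWithinAt)
    rw [(hder c hc.1).deriv, hmass, eq_div_iff (by linarith)] at hslope
    simp only [zero_mul, intervalIntegral.integral_zero, mul_zero, neg_zero] at hslope
    linarith
  have hmax (t : ℝ) (ht : 0 ≤ t) (s : ℝ) (hs : s ∈ Set.Icc (0:ℝ) 1) : u s t ≤ U₀ := by
    obtain ⟨hdiff, hder⟩ := hasDerivAt_integral_comp_superfast hu hupos pde bc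
      (φ := fun x => max (x - U₀) 0 ^ 3) (φ' := fun x => 3 * max (x - U₀) 0 ^ 2)
      (φ'' := fun x => 6 * max (x - U₀) 0)
      (fun x => by convert hasDerivAt_max_sub_zero_pow U₀ 1 x using 1; norm_num)
      (fun x => ((hasDerivAt_max_sub_zero_pow U₀ 0 x).const_mul 3).congr_deriv
        (by push_cast; ring))
      (by fun_prop)
    have hanti : AntitoneOn (fun τ => ∫ s in (0:ℝ)..1, max (u s τ - U₀) 0 ^ 3) (Set.Ici 0) := by
      refine antitoneOn_of_deriv_nonpos (convex_Ici 0)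
        (fun x _ => (hdiff x).continuousAt.continuousWithinAt)
        (fun x _ => (hdiff x).differentiableWithinAt) fun x hx => ?_
      rw [interior_Ici] at hx
      rw [(hder x hx).deriv]
      refine neg_nonpos.2 (mul_nonneg hν.le
        (intervalIntegral.integral_nonneg zero_le_one fun y _ => by positivity))
    have h0 : ∫ s in (0:ℝ)..1, max (u s 0 - U₀) 0 ^ 3 = 0 := by
      rw [intervalIntegral.integral_congr (g := fun _ => 0)]
      · simp
      · intro y hy
        rw [Set.uIcc_of_le zero_le_one] at hy
        simp [max_eq_right (sub_nonpos.2 (hU y hy))]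
    have hle := hanti Set.self_mem_Ici (Set.mem_Ici.2 ht) ht
    simp only [h0] at hle
    by_contra! hlt
    have hpos : 0 < ∫ s in (0:ℝ)..1, max (u s t - U₀) 0 ^ 3 := by
      refine intervalIntegral.integral_pos zero_lt_one ?_ (fun y _ => by positivity)
        ⟨s, hs, pow_pos (lt_max_of_lt_left (sub_pos.2 hlt)) 3⟩
      have := hucont t
      fun_prop
    linarith
  set K := (Real.log U₀ / (U₀ - 1)) ^ 2 with hK
  have hpoinc (t : ℝ) (ht : 0 ≤ t) : K * ∫ s in (0:ℝ)..1, (u s t - 1) ^ 2 ≤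
      ∫ s in (0:ℝ)..1, (deriv (fun z => u z t) s / u s t) ^ 2 := by
    obtain ⟨r, hr, hr1⟩ := exists_eq_interval_average zero_ne_one (hucont t).continuousOn
    rw [interval_average_eq, hmassT t ht] at hr1
    simp only [sub_zero, inv_one, smul_eq_mul, mul_one] at hr1
    rw [Set.uIoo_of_le zero_le_one] at hr
    have hw (s : ℝ) : HasDerivAt (fun z => Real.log (u z t)) (deriv (fun z => u z t) s / u s t) s :=
      ((hus t).differentiable (by simp) s).hasDerivAt.log (hupos s t).ne'
    have hg : Continuous fun s => deriv (fun z => u z t) s / u s t :=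
      ((hus t).continuous_deriv (by simp)).div (hucont t) fun s => (hupos s t).ne'
    rw [← intervalIntegral.integral_const_mul]
    set I := ∫ s in (0:ℝ)..1, (deriv (fun z => u z t) s / u s t) ^ 2 with hI
    have hmono : ∫ s in (0:ℝ)..1, K * (u s t - 1) ^ 2 ≤ ∫ _ in (0:ℝ)..1, I := by
      have := hucont t
      refine intervalIntegral.integral_mono_on zero_le_one
        (Continuous.intervalIntegrable (by fun_prop) _ _) intervalIntegrable_const fun s hs => ?_
      exact (sq_sub_one_mul_le_sq_log hU₀gt (hupos s t) (hmax t ht s hs)).trans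
        (sq_le_integral_deriv_sq hw hg (Set.Ioo_subset_Icc_self hr) hs (by simp [hr1]))
    simpa using hmono
  obtain ⟨hdiff, hder⟩ := hasDerivAt_integral_comp_superfast hu hupos pde bc
    (φ := fun x => (x - 1) ^ 2) (φ' := fun x => 2 * (x - 1)) (φ'' := fun _ => 2)
    (fun x => by simpa using ((hasDerivAt_id x).sub_const 1).fun_pow 2)
    (fun x => by simpa using ((hasDerivAt_id x).sub_const 1).const_mul 2) continuous_const
  have hexp (t : ℝ) : HasDerivAt (fun τ => Real.exp (2 * ν * K * τ))
      (Real.exp (2 * ν * K * t) * (2 * ν * K)) t := by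
    simpa using ((hasDerivAt_id t).const_mul (2 * ν * K)).exp
  have hanti : AntitoneOn
      (fun τ => (∫ s in (0:ℝ)..1, (u s τ - 1) ^ 2) * Real.exp (2 * ν * K * τ)) (Set.Ici 0) := by
    refine antitoneOn_of_deriv_nonpos (convex_Ici 0)
      (fun x _ => ((hdiff x).mul (hexp x).differentiableAt).continuousAt.continuousWithinAt)
      (fun x _ => ((hdiff x).mul (hexp x).differentiableAt).differentiableWithinAt) fun x hx => ?_
    rw [interior_Ici] at hx
    have hx0 : 0 < x := hx
    rw [((hder x hx0).fun_mul (hexp x)).deriv, intervalIntegral.integral_const_mul]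
    have h1 := mul_le_mul_of_nonneg_left (hpoinc x hx0.le)
      (mul_nonneg hν.le (Real.exp_pos (2 * ν * K * x)).le)
    nlinarith
  intro t ht
  have hle := hanti Set.self_mem_Ici (Set.mem_Ici.2 ht) ht
  simp only [mul_zero, Real.exp_zero, mul_one] at hle
  rw [neg_mul, Real.exp_neg, ← div_eq_mul_inv]
  exact (le_div_iff₀ (Real.exp_pos _)).2 hle
end

section
/- Radial Poincaré inequality with Neumann conditions: if g : [0,1] → ℝ is twice continuously differentiable with g'(0) = g'(1) = 0, then ∫₀¹ g'(r)² r dr ≤ (1/4) ∫₀¹ ((d/dr)(r g'(r)))² / r dr. -/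
open MeasureTheory intervalIntegral Real

/-- Hardy-type form of the radial Poincaré inequality: a `C¹` function vanishing at the centre of
the disc is controlled by its weighted divergence. -/
theorem four_mul_integral_sq_mul_le_integral_deriv_mul_sq_div
    (h : ℝ → ℝ) (hh : ContDiff ℝ 1 h) (h0 : h 0 = 0) :
    4 * ∫ r in (0:ℝ)..1, (h r)^2 * r ≤
      ∫ r in (0:ℝ)..1, (deriv (fun ρ => ρ * h ρ) r)^2 / r := by
  have hd : Differentiable ℝ h := hh.differentiable one_ne_zero
  have hc : Continuous h := hh.continuous
  have hc' : Continuous (deriv h) := hh.continuous_deriv le_rfl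
  set k := dslope h 0 with hk
  have hkc : Continuous k := by
    rw [← continuousOn_univ, hk, continuousOn_dslope Filter.univ_mem]
    exact ⟨hc.continuousOn, hd 0⟩
  have hkr (r : ℝ) : h r = r * k r := by
    have := sub_smul_dslope h 0 r
    simp only [sub_zero, smul_eq_mul, h0] at this
    exact this.symm
  have hw (r : ℝ) :
      (deriv (fun ρ => ρ * h ρ) r)^2 / r = r * (k r + deriv h r)^2 := by
    have h1 : HasDerivAt (fun ρ => ρ * h ρ) (1 * h r + r * deriv h r) r :=
      (hasDerivAt_id r).mul (hd r).hasDerivAt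
    rw [h1.deriv, hkr r]
    rcases eq_or_ne r 0 with rfl | hr
    · simp
    · field_simp
  simp only [hw]
  have hF (r : ℝ) : HasDerivAt (fun ρ => 2 * (1 - ρ^2) * (h ρ)^2)
      (4 * (1 - r^2) * h r * deriv h r - 4 * r * (h r)^2) r := by
    have h1 := (((hasDerivAt_pow 2 r).const_sub 1).const_mul 2).fun_mul
      ((hd r).hasDerivAt.fun_pow 2)
    exact h1.congr_deriv (by push_cast; ring)
  have hFint : ∫ r in (0:ℝ)..1,
      (4 * (1 - r^2) * h r * deriv h r - 4 * r * (h r)^2) = 0 := by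
    rw [integral_eq_sub_of_hasDerivAt (fun r _ => hF r)
      (Continuous.intervalIntegrable (by fun_prop) _ _)]
    simp [h0]
  calc 4 * ∫ r in (0:ℝ)..1, (h r)^2 * r
      = ∫ r in (0:ℝ)..1, ((4 * (1 - r^2) * h r * deriv h r - 4 * r * (h r)^2)
          + 4 * ((h r)^2 * r)) := by
        rw [integral_add (Continuous.intervalIntegrable (by fun_prop) _ _)
          (Continuous.intervalIntegrable (by fun_prop) _ _), hFint, zero_add,
          intervalIntegral.integral_const_mul]
    _ ≤ ∫ r in (0:ℝ)..1, r * (k r + deriv h r)^2 := by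
        refine integral_mono_on zero_le_one
          (Continuous.intervalIntegrable (by fun_prop) _ _)
          (Continuous.intervalIntegrable (by fun_prop) _ _) fun r hr => ?_
        rw [hkr r]
        have h1 : 0 ≤ r * (k r + deriv h r - 2 * (1 - r^2) * k r)^2 :=
          mul_nonneg hr.1 (sq_nonneg _)
        have h2 : 0 ≤ r^3 * (1 - r^2) * (k r)^2 :=
          mul_nonneg (mul_nonneg (pow_nonneg hr.1 3) (by nlinarith [hr.1, hr.2]))
            (sq_nonneg _)
        linarith

/-- Radial Poincaré inequality with Neumann conditions: if `g : [0,1] → ℝ` is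
twice continuously differentiable with `g'(0) = g'(1) = 0`, then
`∫₀¹ g'(r)² r dr ≤ (1/4) ∫₀¹ ((d/dr)(r g'(r)))² / r dr`. -/
theorem radial_poincare_neumann
    (g : ℝ → ℝ) (hg : ContDiff ℝ 2 g)
    (hg0 : deriv g 0 = 0) (hg1 : deriv g 1 = 0) :
    ∫ r in (0:ℝ)..1, (deriv g r)^2 * r ≤
      (1/4) * ∫ r in (0:ℝ)..1, (deriv (fun ρ => ρ * deriv g ρ) r)^2 / r := by
  have h := four_mul_integral_sq_mul_le_integral_deriv_mul_sq_div (deriv g)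
    (hg.iterate_deriv' 1 1) hg0
  linarith
end

section
/- Asymptotic exponential decay for radially symmetric solutions (Theorem A.2): let h, v be a smooth solution of the radially symmetric viscous sheet system with the stated boundary conditions which satisfies h(r,t) ≥ m > 0 for all r ∈ [0,1] and all t ≥ 0. Then there exist positive constants A₁, B₁, A₂, B₂, depending only on σ, μ, m and the initial data h(·,0), v(·,0), and a constant h̄ = 2∫₀¹ h(r,0) r dr, such that for all t ≥ 0: ∫₀¹ [ (h(r,t) − h̄)² + h_r(r,t)² ] r dr ≤ A₁ e^{−B₁ t} and ∫₀¹ v(r,t)² r dr ≤ A₂ e^{−B₂ t}. -/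
open MeasureTheory intervalIntegral Real

/-- If `f` equals a total derivative plus `d` on `(0,1)` and the flux vanishes at both end points,
then `f` and `d` have the same integral. -/
lemma integral_eq_of_flux {Φ Φ' f d : ℝ → ℝ} (hΦ : ∀ r, HasDerivAt Φ (Φ' r) r)
    (hΦ' : Continuous Φ') (hd : Continuous d) (h0 : Φ 0 = 0) (h1 : Φ 1 = 0)
    (hfd : ∀ r ∈ Set.Ioo (0:ℝ) 1, f r = Φ' r + d r) :
    ∫ r in (0:ℝ)..1, f r = ∫ r in (0:ℝ)..1, d r := by
  rw [integral_congr_Ioo_of_le zero_le_one (g := fun r => Φ' r + d r) hfd,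
    integral_add (hΦ'.intervalIntegrable _ _) (hd.intervalIntegrable _ _),
    integral_eq_sub_of_hasDerivAt (fun r _ => hΦ r) (hΦ'.intervalIntegrable _ _), h0, h1]
  simp

/-- The profiles of a radial viscous sheet at a fixed positive time. Here `a`, `b`, `c` are the
first three radial derivatives of the height `h`, `v₁`, `v₂` those of the velocity `v`, and
`V = v / r`, `G = a / r`; `ht`, `vt` are time derivatives and `htr` is the mixed derivative. -/
structure SheetSlice (σ μ m : ℝ) where
  (h a b c v v₁ v₂ V G ht htr vt : ℝ → ℝ)
  hasDerivAt_h : ∀ r, HasDerivAt h (a r) r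
  hasDerivAt_a : ∀ r, HasDerivAt a (b r) r
  hasDerivAt_b : ∀ r, HasDerivAt b (c r) r
  hasDerivAt_v : ∀ r, HasDerivAt v (v₁ r) r
  hasDerivAt_v₁ : ∀ r, HasDerivAt v₁ (v₂ r) r
  hasDerivAt_ht : ∀ r, HasDerivAt ht (htr r) r
  continuous_c : Continuous c
  continuous_v₂ : Continuous v₂
  continuous_V : Continuous V
  continuous_G : Continuous G
  continuous_htr : Continuous htr
  continuous_vt : Continuous vt
  v_eq : ∀ r, v r = r * V r
  a_eq : ∀ r, a r = r * G r
  v_one : v 1 = 0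
  a_one : a 1 = 0
  h_pos : ∀ r, 0 < h r
  le_h : ∀ r ∈ Set.Icc (0:ℝ) 1, m ≤ h r
  continuity : ∀ r ∈ Set.Ioo (0:ℝ) 1, r * ht r = -(h r * v r + r * a r * v r + r * h r * v₁ r)
  momentum : ∀ r ∈ Set.Ioo (0:ℝ) 1,
    r * h r * (vt r + v r * v₁ r) = σ * h r * (r * c r + b r - G r) +
      4 * μ * (a r * (r * v₁ r + v r) + h r * (r * v₂ r + v₁ r - V r) - v r * a r / 2)

namespace SheetSlice

variable {σ μ m : ℝ} (S : SheetSlice σ μ m)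

/-- The effective velocity `v + 4μ hᵣ / h` of Bresch and Desjardins. -/
noncomputable def w (r : ℝ) : ℝ := S.v r + 4 * μ * (S.a r / S.h r)

/-- The time derivative of the effective velocity. -/
noncomputable def wt (r : ℝ) : ℝ :=
  S.vt r + 4 * μ * ((S.htr r * S.h r - S.a r * S.ht r) / S.h r ^ 2)

lemma continuous_h : Continuous S.h :=
  continuous_iff_continuousAt.2 fun r => (S.hasDerivAt_h r).continuousAt
lemma continuous_a : Continuous S.a :=
  continuous_iff_continuousAt.2 fun r => (S.hasDerivAt_a r).continuousAt
lemma continuous_b : Continuous S.b :=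
  continuous_iff_continuousAt.2 fun r => (S.hasDerivAt_b r).continuousAt
lemma continuous_v : Continuous S.v :=
  continuous_iff_continuousAt.2 fun r => (S.hasDerivAt_v r).continuousAt
lemma continuous_v₁ : Continuous S.v₁ :=
  continuous_iff_continuousAt.2 fun r => (S.hasDerivAt_v₁ r).continuousAt
lemma continuous_ht : Continuous S.ht :=
  continuous_iff_continuousAt.2 fun r => (S.hasDerivAt_ht r).continuousAt

attribute [fun_prop] continuous_h continuous_a continuous_b continuous_v continuous_v₁
  continuous_ht continuous_c continuous_v₂ continuous_V continuous_G continuous_htr continuous_vt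

lemma h_ne (r : ℝ) : S.h r ≠ 0 := (S.h_pos r).ne'

lemma continuous_w : Continuous S.w := by
  unfold w
  fun_prop (disch := exact S.h_ne)

lemma continuous_wt : Continuous S.wt := by
  unfold wt
  fun_prop (disch := exact fun r => pow_ne_zero 2 (S.h_ne r))

attribute [fun_prop] continuous_w continuous_wt

lemma a_zero : S.a 0 = 0 := by simp [S.a_eq]

lemma v_zero : S.v 0 = 0 := by simp [S.v_eq]

lemma hasDerivAt_w (r : ℝ) : HasDerivAt S.w
    (S.v₁ r + 4 * μ * ((S.b r * S.h r - S.a r * S.a r) / S.h r ^ 2)) r :=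
  (S.hasDerivAt_v r).add
    (((S.hasDerivAt_a r).div (S.hasDerivAt_h r) (S.h_ne r)).const_mul (4 * μ))

lemma ht_eq {r : ℝ} (hr : r ∈ Set.Ioo (0:ℝ) 1) :
    S.ht r = -(S.h r * S.V r + S.a r * S.v r + S.h r * S.v₁ r) := by
  apply mul_left_cancel₀ hr.1.ne'
  rw [S.continuity r hr, S.v_eq]
  ring

lemma htr_eq {r : ℝ} (hr : r ∈ Set.Ioo (0:ℝ) 1) :
    S.ht r + r * S.htr r = -(2 * (S.a r * S.v r + S.h r * S.v₁ r) +
      r * (S.b r * S.v r + 2 * S.a r * S.v₁ r + S.h r * S.v₂ r)) := by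
  have h1 := (hasDerivAt_id r).mul (S.hasDerivAt_ht r)
  have h2 := ((((S.hasDerivAt_h r).mul (S.hasDerivAt_v r)).add
    (((hasDerivAt_id r).mul (S.hasDerivAt_a r)).mul (S.hasDerivAt_v r))).add
    (((hasDerivAt_id r).mul (S.hasDerivAt_h r)).mul (S.hasDerivAt_v₁ r))).neg
  have h3 := h1.congr_of_eventuallyEq (f₁ := _) (Filter.EventuallyEq.symm
    (Filter.eventually_of_mem (isOpen_Ioo.mem_nhds hr) fun y hy => S.continuity y hy))
  have := h3.unique h2
  simp only [id, Pi.mul_apply] at this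
  linear_combination this

/-- The quantities determined by the spatial profiles, on the open interval. -/
lemma solved {r : ℝ} (hr : r ∈ Set.Ioo (0:ℝ) 1) :
    S.V r = S.v r / r ∧ S.G r = S.a r / r ∧
    S.ht r = -(S.h r * (S.v r / r) + S.a r * S.v r + S.h r * S.v₁ r) ∧
    S.htr r = (S.h r * (S.v r / r) - S.a r * S.v r - S.h r * S.v₁ r -
      r * (S.b r * S.v r + 2 * S.a r * S.v₁ r + S.h r * S.v₂ r)) / r ∧
    S.vt r = (σ * S.h r * (r * S.c r + S.b r - S.a r / r) +
      4 * μ * (S.a r * (r * S.v₁ r + S.v r) + S.h r * (r * S.v₂ r + S.v₁ r - S.v r / r) -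
        S.v r * S.a r / 2)) / (r * S.h r) - S.v r * S.v₁ r := by
  have hr0 := hr.1.ne'
  have hV : S.V r = S.v r / r := by rw [S.v_eq]; field_simp
  have hG : S.G r = S.a r / r := by rw [S.a_eq]; field_simp
  have ht := S.ht_eq hr
  have htr := S.htr_eq hr
  have hvt := S.momentum r hr
  rw [hV] at ht
  rw [ht] at htr
  rw [hV, hG] at hvt
  refine ⟨hV, hG, ht, ?_, ?_⟩
  · rw [eq_div_iff hr0]
    linear_combination htr
  · rw [eq_sub_iff_add_eq, eq_div_iff (mul_ne_zero hr0 (S.h_ne r))]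
    linear_combination hvt

lemma energy_rate : (∫ r in (0:ℝ)..1, r * (S.ht r * S.v r ^ 2 / 2 + S.h r * S.v r * S.vt r +
      σ * S.a r * S.htr r)) =
    ∫ r in (0:ℝ)..1, -(4 * μ) * (r * S.h r * (S.V r ^ 2 + S.V r * S.v₁ r + S.v₁ r ^ 2)) := by
  have hΦ : ∀ r, HasDerivAt (fun r => -(r * S.h r * S.v r ^ 3 / 2)
      + σ * (S.h r * S.v r * (S.a r + r * S.b r)) + σ * (r * S.a r * S.ht r)
      + 4 * μ * (S.v r * S.h r * (S.v r + r * S.v₁ r) - S.v r ^ 2 * S.h r / 2)) _ r := fun r =>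
    (((((hasDerivAt_id r).mul (S.hasDerivAt_h r)).mul ((S.hasDerivAt_v r).pow 3)).div_const 2).neg.add
      ((((S.hasDerivAt_h r).mul (S.hasDerivAt_v r)).mul
        ((S.hasDerivAt_a r).add ((hasDerivAt_id r).mul (S.hasDerivAt_b r)))).const_mul σ)).add
      ((((hasDerivAt_id r).mul (S.hasDerivAt_a r)).mul (S.hasDerivAt_ht r)).const_mul σ) |>.add
      (((((S.hasDerivAt_v r).mul (S.hasDerivAt_h r)).mul
        ((S.hasDerivAt_v r).add ((hasDerivAt_id r).mul (S.hasDerivAt_v₁ r)))).sub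
        ((((S.hasDerivAt_v r).pow 2).mul (S.hasDerivAt_h r)).div_const 2)).const_mul (4 * μ))
  refine integral_eq_of_flux hΦ ?_ (by fun_prop) (by simp [S.a_zero, S.v_zero])
    (by simp [S.a_one, S.v_one]) fun r hr => ?_
  · simp only [id, Pi.mul_apply, Pi.pow_apply, Pi.add_apply]
    fun_prop
  · obtain ⟨hV, hG, ht, htr, hvt⟩ := S.solved hr
    simp only [id, Pi.mul_apply, Pi.pow_apply, Pi.add_apply, hvt, htr, ht, hV]
    have := hr.1.ne'
    have := S.h_ne r
    field_simp
    push_cast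
    ring

lemma entropy_rate : (∫ r in (0:ℝ)..1, r * (S.ht r * S.w r ^ 2 / 2 + S.h r * S.w r * S.wt r +
      σ * S.a r * S.htr r)) =
    ∫ r in (0:ℝ)..1, (-(4 * μ * σ) * (r * (S.b r + S.G r) ^ 2) + 2 * μ * (S.a r * S.v r ^ 2) +
      8 * μ ^ 2 * (S.a r ^ 2 * S.v r / S.h r)) := by
  have hΦ : ∀ r, HasDerivAt (fun r => -(r * S.h r * S.v r * S.w r ^ 2 / 2)
      + σ * (S.h r * S.v r * (S.a r + r * S.b r)) + σ * (r * S.a r * S.ht r)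
      + 4 * μ * σ * (S.a r * (S.a r + r * S.b r))) _ r := fun r =>
    ((((((hasDerivAt_id r).mul (S.hasDerivAt_h r)).mul (S.hasDerivAt_v r)).mul
      ((S.hasDerivAt_w r).pow 2)).div_const 2).neg.add
      ((((S.hasDerivAt_h r).mul (S.hasDerivAt_v r)).mul
        ((S.hasDerivAt_a r).add ((hasDerivAt_id r).mul (S.hasDerivAt_b r)))).const_mul σ)).add
      ((((hasDerivAt_id r).mul (S.hasDerivAt_a r)).mul (S.hasDerivAt_ht r)).const_mul σ) |>.add
      (((S.hasDerivAt_a r).mul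
        ((S.hasDerivAt_a r).add ((hasDerivAt_id r).mul (S.hasDerivAt_b r)))).const_mul (4 * μ * σ))
  refine integral_eq_of_flux hΦ ?_ (by fun_prop (disch := exact S.h_ne))
    (by simp [S.a_zero, S.v_zero])
    (by simp [S.a_one, S.v_one]) fun r hr => ?_
  · simp only [id, Pi.mul_apply, Pi.pow_apply, Pi.add_apply]
    fun_prop (disch := exact fun r => pow_ne_zero 2 (S.h_ne r))
  · obtain ⟨hV, hG, ht, htr, hvt⟩ := S.solved hr
    simp only [id, Pi.mul_apply, Pi.pow_apply, Pi.add_apply, w, wt, hvt, htr, ht, hG,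
      Nat.add_one_sub_one, pow_one]
    have := hr.1.ne'
    have := S.h_ne r
    field_simp
    push_cast
    ring

lemma weighted_v_le (hm : 0 < m) {r : ℝ} (hr : r ∈ Set.Icc (0:ℝ) 1) :
    m * S.v r ^ 2 ≤ ∫ x in (0:ℝ)..1, x * S.h x * (S.V x ^ 2 + S.v₁ x ^ 2) := by
  have hftc := integral_eq_sub_of_hasDerivAt (a := 0) (b := r) (f := fun x => S.v x ^ 2)
    (fun x _ => (S.hasDerivAt_v x).pow 2) (Continuous.intervalIntegrable (by fun_prop) _ _)
  simp only [S.v_zero, ne_eq, OfNat.ofNat_ne_zero, not_false_eq_true, zero_pow, sub_zero] at hftc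
  rw [← hftc, ← intervalIntegral.integral_const_mul]
  have hpos : ∀ x ∈ Set.Icc (0:ℝ) 1, 0 ≤ x * S.h x * (S.V x ^ 2 + S.v₁ x ^ 2) := fun x hx =>
    mul_nonneg (mul_nonneg hx.1 (S.h_pos x).le) (by positivity)
  calc _ ≤ ∫ x in (0:ℝ)..r, x * S.h x * (S.V x ^ 2 + S.v₁ x ^ 2) := by
        refine integral_mono_on hr.1 (Continuous.intervalIntegrable (by fun_prop) _ _)
          (Continuous.intervalIntegrable (by fun_prop) _ _) fun x hx => ?_
        have hle := S.le_h x ⟨hx.1, hx.2.trans hr.2⟩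
        have h2 : 2 * S.V x * S.v₁ x ≤ S.V x ^ 2 + S.v₁ x ^ 2 := two_mul_le_add_sq _ _
        calc _ = x * m * (2 * S.V x * S.v₁ x) := by rw [S.v_eq]; norm_num; ring
          _ ≤ x * m * (S.V x ^ 2 + S.v₁ x ^ 2) :=
            mul_le_mul_of_nonneg_left h2 (mul_nonneg hx.1 hm.le)
          _ ≤ _ := by have := hx.1; gcongr
    _ ≤ _ := integral_mono_interval le_rfl hr.1 hr.2
        (ae_restrict_of_forall_mem measurableSet_Ioc fun x hx => hpos x ⟨hx.1.le, hx.2⟩)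
        (Continuous.intervalIntegrable (by fun_prop) _ _)

lemma energy_rate_le (hμ : 0 < μ) :
    (∫ r in (0:ℝ)..1, r * (S.ht r * S.v r ^ 2 / 2 + S.h r * S.v r * S.vt r +
      σ * S.a r * S.htr r)) ≤
    -(2 * μ) * ∫ r in (0:ℝ)..1, r * S.h r * (S.V r ^ 2 + S.v₁ r ^ 2) := by
  rw [S.energy_rate, ← intervalIntegral.integral_const_mul]
  refine integral_mono_on zero_le_one (Continuous.intervalIntegrable (by fun_prop) _ _)
    (Continuous.intervalIntegrable (by fun_prop) _ _) fun r hr => ?_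
  have : 0 ≤ 2 * μ * (r * S.h r) * (S.V r + S.v₁ r) ^ 2 := by
    have := S.h_pos r
    have := hr.1
    positivity
  linear_combination this

lemma integral_a_mul_sq_le :
    ∫ r in (0:ℝ)..1, S.a r * S.v r ^ 2 ≤
      ∫ r in (0:ℝ)..1, r * S.h r * (S.V r ^ 2 + S.v₁ r ^ 2) := by
  rw [integral_eq_of_flux (d := fun r => -(2 * S.h r * S.v r * S.v₁ r))
    (fun r => (S.hasDerivAt_h r).mul ((S.hasDerivAt_v r).pow 2))
    (by simp only [Pi.pow_apply]; fun_prop) (by fun_prop) (by simp [S.v_zero]) (by simp [S.v_one])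
    fun r _ => by simp only [Pi.pow_apply]; push_cast; ring]
  refine integral_mono_on zero_le_one (Continuous.intervalIntegrable (by fun_prop) _ _)
    (Continuous.intervalIntegrable (by fun_prop) _ _) fun r hr => ?_
  have : 0 ≤ r * S.h r * (S.V r + S.v₁ r) ^ 2 := by
    have := S.h_pos r
    have := hr.1
    positivity
  rw [S.v_eq]
  linear_combination this

lemma integral_laplacian_ge :
    ∫ r in (0:ℝ)..1, r * S.G r ^ 2 ≤ ∫ r in (0:ℝ)..1, r * (S.b r + S.G r) ^ 2 := by
  rw [integral_eq_of_flux (f := fun r => r * (S.b r + S.G r) ^ 2)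
    (d := fun r => r * (S.b r ^ 2 + S.G r ^ 2))
    (fun r => (S.hasDerivAt_a r).pow 2)
    (by fun_prop) (by fun_prop) (by simp [S.a_zero]) (by simp [S.a_one])
    fun r _ => by rw [S.a_eq]; push_cast; ring]
  refine integral_mono_on zero_le_one (Continuous.intervalIntegrable (by fun_prop) _ _)
    (Continuous.intervalIntegrable (by fun_prop) _ _) fun r hr => ?_
  exact mul_le_mul_of_nonneg_left (by nlinarith [sq_nonneg (S.b r)]) hr.1

lemma integral_cubic_le (hσ : 0 < σ) (hμ : 0 < μ) (hm : 0 < m) {M : ℝ}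
    (hM : ∫ r in (0:ℝ)..1, r * S.a r ^ 2 ≤ M) :
    8 * μ ^ 2 * ∫ r in (0:ℝ)..1, S.a r ^ 2 * S.v r / S.h r ≤
      2 * μ * σ * (∫ r in (0:ℝ)..1, r * S.G r ^ 2) +
      8 * μ ^ 3 * M / (σ * m ^ 3) *
        ∫ r in (0:ℝ)..1, r * S.h r * (S.V r ^ 2 + S.v₁ r ^ 2) := by
  set Z := ∫ r in (0:ℝ)..1, r * S.h r * (S.V r ^ 2 + S.v₁ r ^ 2) with hZ
  have hv : ∀ r ∈ Set.Icc (0:ℝ) 1, m * S.v r ^ 2 ≤ Z := fun r hr => S.weighted_v_le hm hr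
  have hZ0 : 0 ≤ Z := by simpa [S.v_zero] using hv 0 (by simp)
  calc _ = ∫ r in (0:ℝ)..1, 8 * μ ^ 2 * (S.a r ^ 2 * S.v r / S.h r) := by
        rw [intervalIntegral.integral_const_mul]
    _ ≤ ∫ r in (0:ℝ)..1, (2 * μ * σ * (r * S.G r ^ 2) +
        8 * μ ^ 3 * Z / (σ * m ^ 3) * (r * S.a r ^ 2)) := by
        refine integral_mono_on zero_le_one
          (Continuous.intervalIntegrable (by fun_prop (disch := exact S.h_ne)) _ _)
          (Continuous.intervalIntegrable (by fun_prop) _ _) fun r hr => ?_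
        have hh := S.h_pos r
        have hmh := S.le_h r hr
        have hr0 := hr.1
        have hq : S.a r ^ 2 * S.v r / S.h r = r * (S.G r * (S.a r * S.v r / S.h r)) := by
          rw [pow_two]
          nth_rw 1 [S.a_eq]
          ring
        have hsq : (S.v r / S.h r) ^ 2 ≤ Z / m ^ 3 := by
          rw [div_pow, div_le_div_iff₀ (by positivity) (by positivity)]
          calc S.v r ^ 2 * m ^ 3 = (m * S.v r ^ 2) * m ^ 2 := by ring
            _ ≤ Z * S.h r ^ 2 := by gcongr; exact hv r hr
        have hy : 8 * μ ^ 2 * (S.G r * (S.a r * S.v r / S.h r)) ≤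
            2 * μ * σ * S.G r ^ 2 + 8 * μ ^ 3 / σ * (S.a r * S.v r / S.h r) ^ 2 := by
          have : 0 ≤ 2 * μ / σ * (σ * S.G r - 2 * μ * (S.a r * S.v r / S.h r)) ^ 2 := by
            positivity
          have e : 2 * μ / σ * (σ * S.G r - 2 * μ * (S.a r * S.v r / S.h r)) ^ 2 =
            2 * μ * σ * S.G r ^ 2 + 8 * μ ^ 3 / σ * (S.a r * S.v r / S.h r) ^ 2 -
              8 * μ ^ 2 * (S.G r * (S.a r * S.v r / S.h r)) := by
            field_simp
            ring
          linarith
        calc _ = r * (8 * μ ^ 2 * (S.G r * (S.a r * S.v r / S.h r))) := by rw [hq]; ring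
          _ ≤ r * (2 * μ * σ * S.G r ^ 2 + 8 * μ ^ 3 / σ * (S.a r * S.v r / S.h r) ^ 2) := by
            gcongr
          _ = 2 * μ * σ * (r * S.G r ^ 2) +
              8 * μ ^ 3 / σ * (r * S.a r ^ 2) * (S.v r / S.h r) ^ 2 := by ring
          _ ≤ 2 * μ * σ * (r * S.G r ^ 2) + 8 * μ ^ 3 / σ * (r * S.a r ^ 2) * (Z / m ^ 3) := by
            gcongr
          _ = _ := by field_simp
    _ = 2 * μ * σ * (∫ r in (0:ℝ)..1, r * S.G r ^ 2) +
        8 * μ ^ 3 * Z / (σ * m ^ 3) * ∫ r in (0:ℝ)..1, r * S.a r ^ 2 := by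
        rw [integral_add (Continuous.intervalIntegrable (by fun_prop) _ _)
          (Continuous.intervalIntegrable (by fun_prop) _ _), intervalIntegral.integral_const_mul,
          intervalIntegral.integral_const_mul]
    _ ≤ 2 * μ * σ * (∫ r in (0:ℝ)..1, r * S.G r ^ 2) + 8 * μ ^ 3 * Z / (σ * m ^ 3) * M := by
        gcongr
    _ = _ := by ring

lemma entropy_rate_le (hσ : 0 < σ) (hμ : 0 < μ) (hm : 0 < m) {M : ℝ}
    (hM : ∫ r in (0:ℝ)..1, r * S.a r ^ 2 ≤ M) :
    (∫ r in (0:ℝ)..1, r * (S.ht r * S.w r ^ 2 / 2 + S.h r * S.w r * S.wt r +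
      σ * S.a r * S.htr r)) ≤
    -(2 * μ * σ) * (∫ r in (0:ℝ)..1, r * S.G r ^ 2) +
      (2 * μ + 8 * μ ^ 3 * M / (σ * m ^ 3)) *
        ∫ r in (0:ℝ)..1, r * S.h r * (S.V r ^ 2 + S.v₁ r ^ 2) := by
  rw [S.entropy_rate, integral_add (Continuous.intervalIntegrable (by fun_prop) _ _)
      (Continuous.intervalIntegrable (by fun_prop (disch := exact S.h_ne)) _ _),
    integral_add (Continuous.intervalIntegrable (by fun_prop) _ _)
      (Continuous.intervalIntegrable (by fun_prop) _ _),
    intervalIntegral.integral_const_mul, intervalIntegral.integral_const_mul, intervalIntegral.integral_const_mul]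
  have h1 := mul_le_mul_of_nonneg_left S.integral_laplacian_ge (by positivity : 0 ≤ 4 * μ * σ)
  have h2 := mul_le_mul_of_nonneg_left S.integral_a_mul_sq_le (by positivity : 0 ≤ 2 * μ)
  have h3 := S.integral_cubic_le hσ hμ hm hM
  linarith

lemma integral_a_sq_le :
    ∫ r in (0:ℝ)..1, r * S.a r ^ 2 ≤ ∫ r in (0:ℝ)..1, r * S.G r ^ 2 := by
  refine integral_mono_on zero_le_one (Continuous.intervalIntegrable (by fun_prop) _ _)
    (Continuous.intervalIntegrable (by fun_prop) _ _) fun r hr => ?_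
  rw [S.a_eq, mul_pow]
  exact mul_le_mul_of_nonneg_left
    (mul_le_of_le_one_left (sq_nonneg _) (pow_le_one₀ hr.1 hr.2)) hr.1

lemma integral_kinetic_le :
    ∫ r in (0:ℝ)..1, r * (S.h r * S.v r ^ 2) ≤
      ∫ r in (0:ℝ)..1, r * S.h r * (S.V r ^ 2 + S.v₁ r ^ 2) := by
  refine integral_mono_on zero_le_one (Continuous.intervalIntegrable (by fun_prop) _ _)
    (Continuous.intervalIntegrable (by fun_prop) _ _) fun r hr => ?_
  rw [S.v_eq, mul_pow, ← mul_assoc]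
  refine mul_le_mul_of_nonneg_left ?_ (mul_nonneg hr.1 (S.h_pos r).le)
  have := mul_le_of_le_one_left (sq_nonneg (S.V r)) (pow_le_one₀ (n := 2) hr.1 hr.2)
  nlinarith [sq_nonneg (S.v₁ r)]

lemma mass_rate : ∫ r in (0:ℝ)..1, r * S.ht r = 0 := by
  rw [integral_eq_of_flux (d := fun _ => 0)
    (fun r => (((hasDerivAt_id r).mul (S.hasDerivAt_h r)).mul (S.hasDerivAt_v r)).neg)
    (by simp only [id, Pi.mul_apply]; fun_prop) (by fun_prop) (by simp) (by simp [S.v_one])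
    fun r hr => by rw [S.continuity r hr]; simp only [id, Pi.mul_apply]; ring]
  simp

/-- The energy functional. -/
noncomputable def energy : ℝ :=
  ∫ r in (0:ℝ)..1, r * (S.h r * S.v r ^ 2 / 2 + σ * S.a r ^ 2 / 2)

/-- The Bresch-Desjardins entropy functional. -/
noncomputable def entropy : ℝ :=
  ∫ r in (0:ℝ)..1, r * (S.h r * S.w r ^ 2 / 2 + σ * S.a r ^ 2 / 2)

lemma energy_eq : S.energy = 1 / 2 * (∫ r in (0:ℝ)..1, r * (S.h r * S.v r ^ 2)) +
    σ / 2 * ∫ r in (0:ℝ)..1, r * S.a r ^ 2 := by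
  rw [energy, ← intervalIntegral.integral_const_mul, ← intervalIntegral.integral_const_mul,
    ← integral_add (Continuous.intervalIntegrable (by fun_prop) _ _)
      (Continuous.intervalIntegrable (by fun_prop) _ _)]
  exact integral_congr fun r _ => by ring

lemma entropy_le (hm : 0 < m) :
    S.entropy ≤ (∫ r in (0:ℝ)..1, r * (S.h r * S.v r ^ 2)) +
      (σ / 2 + 16 * μ ^ 2 / m) * ∫ r in (0:ℝ)..1, r * S.a r ^ 2 := by
  rw [entropy, ← intervalIntegral.integral_const_mul,
    ← integral_add (Continuous.intervalIntegrable (by fun_prop) _ _)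
      (Continuous.intervalIntegrable (by fun_prop) _ _)]
  refine integral_mono_on zero_le_one (Continuous.intervalIntegrable (by fun_prop) _ _)
    (Continuous.intervalIntegrable (by fun_prop) _ _) fun r hr => ?_
  have hh := S.h_pos r
  have hmh := S.le_h r hr
  have h1 : S.h r * S.w r ^ 2 / 2 ≤ S.h r * S.v r ^ 2 + 16 * μ ^ 2 / S.h r * S.a r ^ 2 := by
    have h0 : 0 ≤ S.h r / 2 * (S.v r - 4 * μ * (S.a r / S.h r)) ^ 2 := by positivity
    have e : S.h r * S.v r ^ 2 + 16 * μ ^ 2 / S.h r * S.a r ^ 2 - S.h r * S.w r ^ 2 / 2 =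
        S.h r / 2 * (S.v r - 4 * μ * (S.a r / S.h r)) ^ 2 := by
      rw [w]
      field_simp
      ring
    linarith
  have h2 : 16 * μ ^ 2 / S.h r * S.a r ^ 2 ≤ 16 * μ ^ 2 / m * S.a r ^ 2 := by gcongr
  have h3 := mul_le_mul_of_nonneg_left (h1.trans (add_le_add_right h2 _)) hr.1
  linarith

/-- Differential inequality for the combined functional `entropy + K * energy`. -/
lemma lyapunov_rate_le (hσ : 0 < σ) (hμ : 0 < μ) (hm : 0 < m) {M K c : ℝ} (hK : 0 ≤ K)
    (hM : ∫ r in (0:ℝ)..1, r * S.a r ^ 2 ≤ M)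
    (hKM : 4 * μ + 8 * μ ^ 3 * M / (σ * m ^ 3) ≤ 2 * μ * K) (hc0 : 0 ≤ c)
    (hc1 : c * (1 + K / 2) ≤ 2 * μ)
    (hc2 : c * (σ / 2 + 16 * μ ^ 2 / m + K * (σ / 2)) ≤ 2 * μ * σ) :
    (∫ r in (0:ℝ)..1, r * (S.ht r * S.w r ^ 2 / 2 + S.h r * S.w r * S.wt r +
      σ * S.a r * S.htr r)) +
    K * (∫ r in (0:ℝ)..1, r * (S.ht r * S.v r ^ 2 / 2 + S.h r * S.v r * S.vt r +
      σ * S.a r * S.htr r)) ≤ -c * (S.entropy + K * S.energy) := by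
  have h1 := S.entropy_rate_le hσ hμ hm hM
  have h2 := mul_le_mul_of_nonneg_left (S.energy_rate_le hμ) hK
  have h3 := mul_le_mul_of_nonneg_left (S.entropy_le hm) hc0
  have h4 := S.energy_eq
  have hkin : 0 ≤ ∫ r in (0:ℝ)..1, r * (S.h r * S.v r ^ 2) :=
    integral_nonneg zero_le_one fun r hr =>
      mul_nonneg hr.1 (mul_nonneg (S.h_pos r).le (sq_nonneg _))
  have ha : 0 ≤ ∫ r in (0:ℝ)..1, r * S.a r ^ 2 :=
    integral_nonneg zero_le_one fun r hr => mul_nonneg hr.1 (sq_nonneg _)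
  have hZ := hkin.trans S.integral_kinetic_le
  have h5 := mul_le_mul_of_nonneg_right hKM hZ
  have h6 := mul_le_mul_of_nonneg_left S.integral_kinetic_le (by positivity : 0 ≤ 2 * μ)
  have h7 := mul_le_mul_of_nonneg_left S.integral_a_sq_le (by positivity : 0 ≤ 2 * μ * σ)
  have h8 := mul_le_mul_of_nonneg_right hc1 hkin
  have h9 := mul_le_mul_of_nonneg_right hc2 ha
  rw [h4]
  linarith

end SheetSlice

/-- Radial derivative of a function of `(r, t)`. -/
noncomputable def radialDeriv (f : ℝ × ℝ → ℝ) (p : ℝ × ℝ) : ℝ := fderiv ℝ f p (1, 0)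

/-- Time derivative of a function of `(r, t)`. -/
noncomputable def timeDeriv (f : ℝ × ℝ → ℝ) (p : ℝ × ℝ) : ℝ := fderiv ℝ f p (0, 1)

section Partial

variable {f : ℝ × ℝ → ℝ} (hf : ContDiff ℝ (⊤ : ℕ∞) f)

include hf

lemma contDiff_radialDeriv : ContDiff ℝ (⊤ : ℕ∞) (radialDeriv f) :=
  (hf.fderiv_right (m := (⊤ : ℕ∞)) le_rfl).clm_apply contDiff_const

lemma contDiff_timeDeriv : ContDiff ℝ (⊤ : ℕ∞) (timeDeriv f) :=
  (hf.fderiv_right (m := (⊤ : ℕ∞)) le_rfl).clm_apply contDiff_const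

lemma hasDerivAt_radialDeriv (r t : ℝ) :
    HasDerivAt (fun ρ => f (ρ, t)) (radialDeriv f (r, t)) r :=
  ((hf.differentiable (by simp)) (r, t)).hasFDerivAt.comp_hasDerivAt r
    ((hasDerivAt_id r).prodMk (hasDerivAt_const r t))

lemma hasDerivAt_timeDeriv (r t : ℝ) :
    HasDerivAt (fun τ => f (r, τ)) (timeDeriv f (r, t)) t :=
  ((hf.differentiable (by simp)) (r, t)).hasFDerivAt.comp_hasDerivAt t
    ((hasDerivAt_const t r).prodMk (hasDerivAt_id t))

lemma timeDeriv_radialDeriv (p : ℝ × ℝ) :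
    timeDeriv (radialDeriv f) p = radialDeriv (timeDeriv f) p := by
  have hd : DifferentiableAt ℝ (fderiv ℝ f) p :=
    (hf.fderiv_right (m := (⊤ : ℕ∞)) le_rfl).differentiable (by simp) p
  have hs : IsSymmSndFDerivAt ℝ f p := hf.contDiffAt.isSymmSndFDerivAt (by
    simpa using WithTop.coe_le_coe.2 (le_top : (2 : ℕ∞) ≤ ⊤))
  have key : ∀ x y : ℝ × ℝ, fderiv ℝ (fun q => fderiv ℝ f q x) p y =
      fderiv ℝ (fderiv ℝ f) p y x := fun x y => by
    rw [fderiv_clm_apply hd (differentiableAt_const x)]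
    simp
  exact (key _ _).trans ((hs _ _).trans (key _ _).symm)

end Partial

/-- Differentiation under the integral sign over the unit interval. -/
lemma hasDerivAt_integral_of_continuous {f f' : ℝ × ℝ → ℝ} (hf : Continuous f)
    (hf' : Continuous f') (hd : ∀ r t, HasDerivAt (fun τ => f (r, τ)) (f' (r, t)) t) (t : ℝ) :
    HasDerivAt (fun τ => ∫ r in (0:ℝ)..1, f (r, τ)) (∫ r in (0:ℝ)..1, f' (r, t)) t := by
  obtain ⟨C, hC⟩ := (isCompact_Icc.prod isCompact_Icc :
    IsCompact (Set.Icc (0:ℝ) 1 ×ˢ Set.Icc (t - 1) (t + 1))).exists_bound_of_continuousOn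
      hf'.continuousOn
  refine (hasDerivAt_integral_of_dominated_loc_of_deriv_le (bound := fun _ => C)
    (F := fun τ r => f (r, τ)) (F' := fun τ r => f' (r, τ))
    (Icc_mem_nhds (sub_one_lt t) (lt_add_one t)) (.of_forall fun τ => ?_)
    (Continuous.intervalIntegrable (by fun_prop) _ _) ?_ (.of_forall fun r hr τ hτ => ?_)
    intervalIntegrable_const (.of_forall fun r _ τ _ => hd r τ)).2
  · exact Continuous.aestronglyMeasurable (by fun_prop)
  · exact Continuous.aestronglyMeasurable (by fun_prop)
  · rw [Set.uIoc_of_le zero_le_one] at hr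
    exact hC (r, τ) ⟨⟨hr.1.le, hr.2⟩, hτ⟩

lemma le_mul_exp_of_deriv_le {f f' : ℝ → ℝ} {c : ℝ} (hf : ∀ t, HasDerivAt f (f' t) t)
    (hle : ∀ t, 0 < t → f' t ≤ -c * f t) {t : ℝ} (ht : 0 ≤ t) :
    f t ≤ f 0 * Real.exp (-c * t) := by
  have hg : ∀ t, HasDerivAt (fun t => f t * Real.exp (c * t))
      (f' t * Real.exp (c * t) + f t * (Real.exp (c * t) * (c * 1))) t := fun t =>
    (hf t).mul (((hasDerivAt_id t).const_mul c).exp)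
  have hanti : AntitoneOn (fun t => f t * Real.exp (c * t)) (Set.Ici 0) := by
    refine antitoneOn_of_deriv_nonpos (convex_Ici 0)
      (fun t _ => (hg t).continuousAt.continuousWithinAt)
      (fun t _ => (hg t).differentiableAt.differentiableWithinAt) fun t ht => ?_
    rw [interior_Ici] at ht
    rw [(hg t).deriv]
    have := mul_le_mul_of_nonneg_right (hle t ht) (Real.exp_pos (c * t)).le
    linarith
  have h := hanti Set.self_mem_Ici ht ht
  simp only [mul_zero, Real.exp_zero, mul_one] at h
  rw [neg_mul, Real.exp_neg, ← div_eq_mul_inv, le_div_iff₀ (Real.exp_pos _)]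
  exact h

/-- A Poincaré inequality for radial functions on the unit disc. -/
lemma integral_sub_mean_sq_le {f f' : ℝ → ℝ} (hf : ∀ r, HasDerivAt f (f' r) r)
    (hf' : Continuous f') :
    ∫ r in (0:ℝ)..1, r * (f r - 2 * ∫ ρ in (0:ℝ)..1, ρ * f ρ) ^ 2 ≤
      ∫ r in (0:ℝ)..1, r * f' r ^ 2 := by
  have hfc : Continuous f := continuous_iff_continuousAt.2 fun r => (hf r).continuousAt
  set I := ∫ ρ in (0:ℝ)..1, ρ * f ρ with hI
  have hsub : ∀ k : ℝ, ∫ r in (0:ℝ)..1, r * (f r - k) ^ 2 =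
      (∫ r in (0:ℝ)..1, r * f r ^ 2) - 2 * k * I + k ^ 2 / 2 := fun k => by
    have e : ∀ r, r * (f r - k) ^ 2 = r * f r ^ 2 - 2 * k * (r * f r) + k ^ 2 * r := fun r => by
      ring
    simp only [e]
    rw [integral_add (Continuous.intervalIntegrable (by fun_prop) _ _)
        (Continuous.intervalIntegrable (by fun_prop) _ _),
      integral_sub (Continuous.intervalIntegrable (by fun_prop) _ _)
        (Continuous.intervalIntegrable (by fun_prop) _ _),
      intervalIntegral.integral_const_mul, intervalIntegral.integral_const_mul, integral_id]
    ring
  have hmin : ∫ r in (0:ℝ)..1, r * (f r - 2 * I) ^ 2 ≤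
      ∫ r in (0:ℝ)..1, r * (f r - f 1) ^ 2 := by
    rw [hsub, hsub]
    linarith [sq_nonneg (f 1 - 2 * I)]
  refine hmin.trans ?_
  have hparts := integral_eq_of_flux (f := fun r => r * (f r - f 1) ^ 2)
    (d := fun r => -(r ^ 2 * (f r - f 1) * f' r))
    (fun r => (((hasDerivAt_id r).pow 2).mul (((hf r).sub_const (f 1)).pow 2)).div_const 2)
    (by simp only [id, Pi.pow_apply]; fun_prop) (by fun_prop) (by simp) (by simp)
    (fun r _ => by simp only [id, Pi.pow_apply]; push_cast; ring)
  have hle : ∫ r in (0:ℝ)..1, -(r ^ 2 * (f r - f 1) * f' r) ≤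
      ∫ r in (0:ℝ)..1, (1 / 2 * (r * (f r - f 1) ^ 2) + 1 / 2 * (r * f' r ^ 2)) := by
    refine integral_mono_on zero_le_one (Continuous.intervalIntegrable (by fun_prop) _ _)
      (Continuous.intervalIntegrable (by fun_prop) _ _) fun r hr => ?_
    have h1 : 0 ≤ r * (r * (f r - f 1) + f' r) ^ 2 := mul_nonneg hr.1 (sq_nonneg _)
    have h2 : 0 ≤ r * (1 - r ^ 2) * (f r - f 1) ^ 2 :=
      mul_nonneg (mul_nonneg hr.1 (by nlinarith [hr.1, hr.2])) (sq_nonneg _)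
    linarith
  rw [integral_add (Continuous.intervalIntegrable (by fun_prop) _ _)
      (Continuous.intervalIntegrable (by fun_prop) _ _),
    intervalIntegral.integral_const_mul, intervalIntegral.integral_const_mul] at hle
  linarith

lemma continuous_dslope_zero {f f' : ℝ → ℝ} (hf : ∀ r, HasDerivAt f (f' r) r) :
    Continuous (dslope f 0) := by
  refine continuous_iff_continuousAt.2 fun r => ?_
  rcases eq_or_ne r 0 with rfl | hr
  · exact continuousAt_dslope_same.2 (hf 0).differentiableAt
  · exact (continuousAt_dslope_of_ne hr).2 (hf r).continuousAt

lemma eq_mul_dslope_zero {f : ℝ → ℝ} (h0 : f 0 = 0) (r : ℝ) : f r = r * dslope f 0 r := by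
  simpa [h0] using (sub_smul_dslope f 0 r).symm

lemma deriv_radial_laplacian {h a b c : ℝ → ℝ} (hh : ∀ r, HasDerivAt h (a r) r)
    (ha : ∀ r, HasDerivAt a (b r) r) (hb : ∀ r, HasDerivAt b (c r) r) {r : ℝ} (hr : r ≠ 0) :
    deriv (fun ρ => deriv (fun y => y * deriv h y) ρ / ρ) r = c r + b r / r - a r / r ^ 2 := by
  have e1 : deriv h = a := funext fun y => (hh y).deriv
  have e2 : (fun ρ => deriv (fun y => y * a y) ρ / ρ) = fun ρ => (1 * a ρ + ρ * b ρ) / ρ :=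
    funext fun ρ => congrArg (· / ρ) ((hasDerivAt_id ρ).mul (ha ρ)).deriv
  rw [e1, e2]
  refine ((((ha r).const_mul 1).add ((hasDerivAt_id r).mul (hb r))).div
    (hasDerivAt_id r) hr).deriv.trans ?_
  simp only [id, Pi.add_apply, Pi.mul_apply]
  field_simp
  ring

lemma deriv_radial_stress {h a v v₁ v₂ : ℝ → ℝ} (hh : ∀ r, HasDerivAt h (a r) r)
    (hv : ∀ r, HasDerivAt v (v₁ r) r) (hv₁ : ∀ r, HasDerivAt v₁ (v₂ r) r) {r : ℝ} (hr : r ≠ 0) :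
    deriv (fun ρ => h ρ / ρ * deriv (fun y => y * v y) ρ) r =
      a r * (v r / r + v₁ r) + h r * (v₁ r / r - v r / r ^ 2 + v₂ r) := by
  have e : (fun ρ => h ρ / ρ * deriv (fun y => y * v y) ρ) =
      fun ρ => h ρ / ρ * (1 * v ρ + ρ * v₁ ρ) :=
    funext fun ρ => congrArg (h ρ / ρ * ·) ((hasDerivAt_id ρ).mul (hv ρ)).deriv
  rw [e]
  refine (((hh r).div (hasDerivAt_id r) hr).mul
    (((hv r).const_mul 1).add ((hasDerivAt_id r).mul (hv₁ r)))).deriv.trans ?_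
  simp only [id, Pi.add_apply, Pi.mul_apply, Pi.div_apply]
  field_simp
  ring

/-- The profiles at time `t` of a smooth solution of the radial viscous sheet system. -/
noncomputable def sheetSliceOfSolution {σ μ m : ℝ} {h v : ℝ → ℝ → ℝ}
    (hh : ContDiff ℝ (⊤ : ℕ∞) (fun p : ℝ × ℝ => h p.1 p.2))
    (hv : ContDiff ℝ (⊤ : ℕ∞) (fun p : ℝ × ℝ => v p.1 p.2))
    (hpos : ∀ r t : ℝ, 0 < h r t) (t : ℝ)
    (momentum : ∀ r ∈ Set.Ioo (0:ℝ) 1,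
      deriv (fun τ => v r τ) t + v r t * deriv (fun ρ => v ρ t) r =
        σ * deriv (fun ρ => (deriv (fun y => y * deriv (fun z => h z t) y) ρ) / ρ) r +
          (4 * μ / h r t) *
            (deriv (fun ρ => (h ρ t / ρ) * deriv (fun y => y * v y t) ρ) r -
              v r t * deriv (fun y => h y t) r / (2 * r)))
    (continuity : ∀ r ∈ Set.Ioo (0:ℝ) 1,
      deriv (fun τ => h r τ) t = -(deriv (fun ρ => ρ * h ρ t * v ρ t) r) / r)
    (bch : deriv (fun ρ => h ρ t) 0 = 0 ∧ deriv (fun ρ => h ρ t) 1 = 0)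
    (bcv : v 0 t = 0 ∧ v 1 t = 0) (hlb : ∀ r ∈ Set.Icc (0:ℝ) 1, m ≤ h r t) :
    SheetSlice σ μ m :=
  let H : ℝ × ℝ → ℝ := fun p => h p.1 p.2
  let U : ℝ × ℝ → ℝ := fun p => v p.1 p.2
  have hH : ContDiff ℝ (⊤ : ℕ∞) H := hh
  have hU : ContDiff ℝ (⊤ : ℕ∞) U := hv
  have dh : ∀ r, HasDerivAt (fun ρ => h ρ t) (radialDeriv H (r, t)) r := fun r =>
    hasDerivAt_radialDeriv hH r t
  have dv : ∀ r, HasDerivAt (fun ρ => v ρ t) (radialDeriv U (r, t)) r := fun r =>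
    hasDerivAt_radialDeriv hU r t
  have da := fun r => hasDerivAt_radialDeriv (contDiff_radialDeriv hH) r t
  have db := fun r => hasDerivAt_radialDeriv (contDiff_radialDeriv (contDiff_radialDeriv hH)) r t
  have dv₁ := fun r => hasDerivAt_radialDeriv (contDiff_radialDeriv hU) r t
  have a0 : radialDeriv H (0, t) = 0 := (dh 0).deriv.symm.trans bch.1
  { h := fun r => h r t
    a := fun r => radialDeriv H (r, t)
    b := fun r => radialDeriv (radialDeriv H) (r, t)
    c := fun r => radialDeriv (radialDeriv (radialDeriv H)) (r, t)
    v := fun r => v r t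
    v₁ := fun r => radialDeriv U (r, t)
    v₂ := fun r => radialDeriv (radialDeriv U) (r, t)
    V := dslope (fun r => v r t) 0
    G := dslope (fun r => radialDeriv H (r, t)) 0
    ht := fun r => timeDeriv H (r, t)
    htr := fun r => timeDeriv (radialDeriv H) (r, t)
    vt := fun r => timeDeriv U (r, t)
    hasDerivAt_h := dh
    hasDerivAt_a := da
    hasDerivAt_b := db
    hasDerivAt_v := dv
    hasDerivAt_v₁ := dv₁
    hasDerivAt_ht := fun r => by
      rw [timeDeriv_radialDeriv hH]
      exact hasDerivAt_radialDeriv (contDiff_timeDeriv hH) r t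
    continuous_c := (contDiff_radialDeriv
      (contDiff_radialDeriv (contDiff_radialDeriv hH))).continuous.comp (by fun_prop)
    continuous_v₂ := (contDiff_radialDeriv (contDiff_radialDeriv hU)).continuous.comp
      (by fun_prop)
    continuous_V := continuous_dslope_zero dv
    continuous_G := continuous_dslope_zero da
    continuous_htr := (contDiff_timeDeriv (contDiff_radialDeriv hH)).continuous.comp (by fun_prop)
    continuous_vt := (contDiff_timeDeriv hU).continuous.comp (by fun_prop)
    v_eq := eq_mul_dslope_zero bcv.1
    a_eq := eq_mul_dslope_zero a0
    v_one := bcv.2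
    a_one := (dh 1).deriv.symm.trans bch.2
    h_pos := fun r => hpos r t
    le_h := hlb
    continuity := fun r hr => by
      have h1 := continuity r hr
      rw [(hasDerivAt_timeDeriv hH r t).deriv] at h1
      rw [h1, mul_div_cancel₀ _ hr.1.ne']
      refine congrArg (- ·)
        (((((hasDerivAt_id r).mul (dh r)).mul (dv r)).deriv).trans ?_)
      simp only [id, Pi.mul_apply]
      ring
    momentum := fun r hr => by
      have hr0 := hr.1.ne'
      have hh0 := (hpos r t).ne'
      have h1 := momentum r hr
      rw [(hasDerivAt_timeDeriv hU r t).deriv, (dv r).deriv, deriv_radial_laplacian dh da db hr0,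
        deriv_radial_stress dh dv dv₁ hr0, (dh r).deriv] at h1
      have hG : dslope (fun r => radialDeriv H (r, t)) 0 r = radialDeriv H (r, t) / r := by
        rw [eq_div_iff hr0, mul_comm]
        exact (eq_mul_dslope_zero a0 r).symm
      have hV : dslope (fun r => v r t) 0 r = v r t / r := by
        rw [eq_div_iff hr0, mul_comm]
        exact (eq_mul_dslope_zero (f := fun r => v r t) bcv.1 r).symm
      rw [h1, hG, hV]
      field_simp
      ring }

/-- Asymptotic exponential decay for radially symmetric solutions
(Theorem A.2): if a smooth solution of the radially symmetric viscous sheet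
system satisfies `h(r,t) ≥ m > 0` for all `r ∈ [0,1]` and `t ≥ 0`, then with
`h̄ = 2∫₀¹ h(r,0) r dr` there exist positive constants `A₁, B₁, A₂, B₂` such
that for all `t ≥ 0`:
`∫₀¹ [(h − h̄)² + h_r²] r dr ≤ A₁ e^{−B₁ t}` and
`∫₀¹ v² r dr ≤ A₂ e^{−B₂ t}`. -/
theorem radial_asymptotic_exponential_decay
    (σ μ : ℝ) (hσ : 0 < σ) (hμ : 0 < μ)
    (h v : ℝ → ℝ → ℝ)
    (hh : ContDiff ℝ (⊤ : ℕ∞) (fun p : ℝ × ℝ => h p.1 p.2))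
    (hv : ContDiff ℝ (⊤ : ℕ∞) (fun p : ℝ × ℝ => v p.1 p.2))
    (hpos : ∀ r t : ℝ, 0 < h r t)
    (momentum : ∀ r ∈ Set.Ioo (0:ℝ) 1, ∀ t : ℝ, 0 < t →
      deriv (fun τ => v r τ) t + v r t * deriv (fun ρ => v ρ t) r =
        σ * deriv (fun ρ => (deriv (fun y => y * deriv (fun z => h z t) y) ρ) / ρ) r +
          (4 * μ / h r t) *
            (deriv (fun ρ => (h ρ t / ρ) * deriv (fun y => y * v y t) ρ) r -
              v r t * deriv (fun y => h y t) r / (2 * r)))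
    (continuity : ∀ r ∈ Set.Ioo (0:ℝ) 1, ∀ t : ℝ, 0 < t →
      deriv (fun τ => h r τ) t = -(deriv (fun ρ => ρ * h ρ t * v ρ t) r) / r)
    (bch : ∀ t : ℝ, 0 ≤ t →
      deriv (fun ρ => h ρ t) 0 = 0 ∧ deriv (fun ρ => h ρ t) 1 = 0)
    (bcv : ∀ t : ℝ, 0 ≤ t → v 0 t = 0 ∧ v 1 t = 0)
    (m : ℝ) (hm : 0 < m)
    (hlb : ∀ r ∈ Set.Icc (0:ℝ) 1, ∀ t : ℝ, 0 ≤ t → m ≤ h r t) :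
    ∃ A₁ B₁ A₂ B₂ : ℝ, 0 < A₁ ∧ 0 < B₁ ∧ 0 < A₂ ∧ 0 < B₂ ∧
      ∀ t : ℝ, 0 ≤ t →
        (∫ r in (0:ℝ)..1,
            ((h r t - 2 * ∫ ρ in (0:ℝ)..1, h ρ 0 * ρ)^2 +
              (deriv (fun ρ => h ρ t) r)^2) * r) ≤ A₁ * Real.exp (-B₁ * t) ∧
        (∫ r in (0:ℝ)..1, (v r t)^2 * r) ≤ A₂ * Real.exp (-B₂ * t) := by
  set H : ℝ × ℝ → ℝ := fun p => h p.1 p.2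
  set U : ℝ × ℝ → ℝ := fun p => v p.1 p.2
  have cH : Continuous H := hh.continuous
  have cU : Continuous U := hv.continuous
  have ca : Continuous (radialDeriv H) := (contDiff_radialDeriv hh).continuous
  have cht : Continuous (timeDeriv H) := (contDiff_timeDeriv hh).continuous
  have cvt : Continuous (timeDeriv U) := (contDiff_timeDeriv hv).continuous
  have chtr : Continuous (timeDeriv (radialDeriv H)) :=
    (contDiff_timeDeriv (contDiff_radialDeriv hh)).continuous
  have hH0 : ∀ p : ℝ × ℝ, H p ≠ 0 := fun p => (hpos p.1 p.2).ne'
  have dh := hasDerivAt_timeDeriv hh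
  have dv := hasDerivAt_timeDeriv hv
  have da := hasDerivAt_timeDeriv (contDiff_radialDeriv hh)
  let S : ∀ t : ℝ, 0 < t → SheetSlice σ μ m := fun t ht =>
    sheetSliceOfSolution hh hv hpos t (fun r hr => momentum r hr t ht)
      (fun r hr => continuity r hr t ht) (bch t ht.le) (bcv t ht.le) (fun r hr => hlb r hr t ht.le)
  let W : ℝ × ℝ → ℝ := fun p => U p + 4 * μ * (radialDeriv H p / H p)
  let Wt : ℝ × ℝ → ℝ := fun p => timeDeriv U p + 4 * μ *
    ((timeDeriv (radialDeriv H) p * H p - radialDeriv H p * timeDeriv H p) / H p ^ 2)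
  have cW : Continuous W := by fun_prop (disch := exact hH0)
  have cWt : Continuous Wt := by fun_prop (disch := exact fun p => pow_ne_zero 2 (hH0 p))
  have dW : ∀ r t, HasDerivAt (fun τ => W (r, τ)) (Wt (r, t)) t := fun r t =>
    (dv r t).add (((da r t).div (dh r t) (hH0 (r, t))).const_mul (4 * μ))
  -- the mass, the energy and the entropy as functions of time
  let Mass : ℝ → ℝ := fun t => ∫ r in (0:ℝ)..1, r * H (r, t)
  let E : ℝ → ℝ := fun t =>
    ∫ r in (0:ℝ)..1, r * (H (r, t) * U (r, t) ^ 2 / 2 + σ * radialDeriv H (r, t) ^ 2 / 2)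
  let N : ℝ → ℝ := fun t =>
    ∫ r in (0:ℝ)..1, r * (H (r, t) * W (r, t) ^ 2 / 2 + σ * radialDeriv H (r, t) ^ 2 / 2)
  have dMass : ∀ t, HasDerivAt Mass (∫ r in (0:ℝ)..1, r * timeDeriv H (r, t)) t :=
    hasDerivAt_integral_of_continuous (f := fun p => p.1 * H p)
      (f' := fun p => p.1 * timeDeriv H p) (by fun_prop) (by fun_prop)
      fun r t => (dh r t).const_mul r
  have dE : ∀ t, HasDerivAt E (∫ r in (0:ℝ)..1, r * (timeDeriv H (r, t) * U (r, t) ^ 2 / 2 +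
      H (r, t) * U (r, t) * timeDeriv U (r, t) +
      σ * radialDeriv H (r, t) * timeDeriv (radialDeriv H) (r, t))) t :=
    hasDerivAt_integral_of_continuous
      (f := fun p => p.1 * (H p * U p ^ 2 / 2 + σ * radialDeriv H p ^ 2 / 2))
      (f' := fun p => p.1 * (timeDeriv H p * U p ^ 2 / 2 + H p * U p * timeDeriv U p +
        σ * radialDeriv H p * timeDeriv (radialDeriv H) p)) (by fun_prop) (by fun_prop)
      fun r t => by
        refine ((((dh r t).mul ((dv r t).pow 2)).div_const 2).add
          ((((da r t).pow 2).const_mul σ).div_const 2)).const_mul r |>.congr_deriv ?_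
        simp only [Pi.pow_apply]
        push_cast
        ring
  have dN : ∀ t, HasDerivAt N (∫ r in (0:ℝ)..1, r * (timeDeriv H (r, t) * W (r, t) ^ 2 / 2 +
      H (r, t) * W (r, t) * Wt (r, t) +
      σ * radialDeriv H (r, t) * timeDeriv (radialDeriv H) (r, t))) t :=
    hasDerivAt_integral_of_continuous
      (f := fun p => p.1 * (H p * W p ^ 2 / 2 + σ * radialDeriv H p ^ 2 / 2))
      (f' := fun p => p.1 * (timeDeriv H p * W p ^ 2 / 2 + H p * W p * Wt p +
        σ * radialDeriv H p * timeDeriv (radialDeriv H) p)) (by fun_prop) (by fun_prop)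
      fun r t => by
        refine ((((dh r t).mul ((dW r t).pow 2)).div_const 2).add
          ((((da r t).pow 2).const_mul σ).div_const 2)).const_mul r |>.congr_deriv ?_
        simp only [Pi.pow_apply]
        push_cast
        ring
  have mass_eq : ∀ t, 0 ≤ t → Mass t = Mass 0 := fun t ht => by
    have h0 : ∀ s, 0 < s → ∫ r in (0:ℝ)..1, r * timeDeriv H (r, s) = 0 := fun s hs =>
      (S s hs).mass_rate
    have h1 := le_mul_exp_of_deriv_le (c := 0) dMass (fun s hs => by rw [h0 s hs]; simp) ht
    have h2 := le_mul_exp_of_deriv_le (c := 0) (fun s => (dMass s).neg)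
      (fun s hs => by rw [h0 s hs]; simp) ht
    simp only [Pi.neg_apply, neg_zero, zero_mul, Real.exp_zero, mul_one] at h1 h2
    linarith
  have E_le : ∀ t, 0 ≤ t → E t ≤ E 0 := fun t ht => by
    have h1 := le_mul_exp_of_deriv_le (c := 0) dE (fun s hs => by
      refine ((S s hs).energy_rate_le hμ).trans ?_
      rw [neg_zero, zero_mul, neg_mul, neg_nonpos]
      exact mul_nonneg (by positivity) (integral_nonneg zero_le_one fun r hr =>
        mul_nonneg (mul_nonneg hr.1 ((S s hs).h_pos r).le) (by positivity))) ht
    simpa using h1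
  have a_le : ∀ t, ∫ r in (0:ℝ)..1, r * radialDeriv H (r, t) ^ 2 ≤ 2 / σ * E t := fun t => by
    rw [← intervalIntegral.integral_const_mul]
    refine integral_mono_on zero_le_one (Continuous.intervalIntegrable (by fun_prop) _ _)
      (Continuous.intervalIntegrable (by fun_prop) _ _) fun r hr => ?_
    have : 0 ≤ r * (H (r, t) * U (r, t) ^ 2 / σ) :=
      mul_nonneg hr.1 (div_nonneg (mul_nonneg (hpos r t).le (sq_nonneg _)) hσ.le)
    have e : 2 / σ * (r * (H (r, t) * U (r, t) ^ 2 / 2 + σ * radialDeriv H (r, t) ^ 2 / 2)) =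
        r * radialDeriv H (r, t) ^ 2 + r * (H (r, t) * U (r, t) ^ 2 / σ) := by
      field_simp
      ring
    linarith
  have v_le : ∀ t, 0 ≤ t → ∫ r in (0:ℝ)..1, r * U (r, t) ^ 2 ≤ 2 / m * E t := fun t ht => by
    rw [← intervalIntegral.integral_const_mul]
    refine integral_mono_on zero_le_one (Continuous.intervalIntegrable (by fun_prop) _ _)
      (Continuous.intervalIntegrable (by fun_prop) _ _) fun r hr => ?_
    have hr0 := hr.1
    calc r * U (r, t) ^ 2 = 2 / m * (r * (m * U (r, t) ^ 2 / 2 + 0)) := by field_simp; ring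
      _ ≤ _ := by
        gcongr
        · exact hlb r hr t ht
        · positivity
  have E_nonneg : ∀ t, 0 ≤ E t := fun t => integral_nonneg zero_le_one fun r hr =>
    mul_nonneg hr.1 (add_nonneg
      (div_nonneg (mul_nonneg (hpos r t).le (sq_nonneg _)) zero_le_two) (by positivity))
  have N_nonneg : ∀ t, 0 ≤ N t := fun t => integral_nonneg zero_le_one fun r hr =>
    mul_nonneg hr.1 (add_nonneg
      (div_nonneg (mul_nonneg (hpos r t).le (sq_nonneg _)) zero_le_two) (by positivity))
  let K : ℝ := 1 + (4 * μ + 8 * μ ^ 3 * (2 / σ * E 0) / (σ * m ^ 3)) / (2 * μ)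
  have hE0 := E_nonneg 0
  have hK1 : 1 ≤ K := le_add_of_nonneg_right (by positivity)
  have hK0 : 0 < K := one_pos.trans_le hK1
  have hKM : 4 * μ + 8 * μ ^ 3 * (2 / σ * E 0) / (σ * m ^ 3) ≤ 2 * μ * K := by
    rw [mul_add, mul_div_cancel₀ _ (by positivity)]
    linarith
  let c : ℝ := min (2 * μ / (1 + K / 2))
    (2 * μ * σ / (σ / 2 + 16 * μ ^ 2 / m + K * (σ / 2)))
  have hc : 0 < c := lt_min (by positivity) (by positivity)
  have hc1 : c * (1 + K / 2) ≤ 2 * μ :=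
    (le_div_iff₀ (by positivity)).1 (min_le_left _ _)
  have hc2 : c * (σ / 2 + 16 * μ ^ 2 / m + K * (σ / 2)) ≤ 2 * μ * σ :=
    (le_div_iff₀ (by positivity)).1 (min_le_right _ _)
  have decay : ∀ t, 0 ≤ t → E t ≤ (N 0 + K * E 0) * Real.exp (-c * t) := fun t ht => by
    have h1 := le_mul_exp_of_deriv_le (c := c) (f := fun t => N t + K * E t)
      (fun s => (dN s).add ((dE s).const_mul K)) (fun s hs =>
        (S s hs).lyapunov_rate_le hσ hμ hm hK0.le
          ((a_le s).trans (mul_le_mul_of_nonneg_left (E_le s hs.le) (by positivity)))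
          hKM hc.le hc1 hc2) ht
    have h2 := mul_le_mul_of_nonneg_right hK1 (E_nonneg t)
    have h3 := N_nonneg t
    linarith
  have hF0 : 0 ≤ N 0 + K * E 0 := add_nonneg (N_nonneg 0) (mul_nonneg hK0.le hE0)
  refine ⟨4 / σ * (N 0 + K * E 0 + 1), c, 2 / m * (N 0 + K * E 0 + 1), c, by positivity, hc,
    by positivity, hc, fun t ht => ?_⟩
  have hdec : E t ≤ (N 0 + K * E 0 + 1) * Real.exp (-c * t) :=
    (decay t ht).trans
      (mul_le_mul_of_nonneg_right (le_add_of_nonneg_right zero_le_one) (Real.exp_pos _).le)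
  have dr : ∀ r, HasDerivAt (fun ρ => h ρ t) (radialDeriv H (r, t)) r := fun r =>
    hasDerivAt_radialDeriv hh r t
  have cht' : Continuous fun r => h r t := cH.comp (by fun_prop : Continuous fun r : ℝ => (r, t))
  constructor
  · have hmean : ∫ ρ in (0:ℝ)..1, h ρ 0 * ρ = ∫ ρ in (0:ℝ)..1, ρ * h ρ t := by
      simp only [mul_comm _ (_ : ℝ)]
      exact (mass_eq t ht).symm
    have hpoinc := integral_sub_mean_sq_le dr (by fun_prop)
    rw [hmean]
    set I := 2 * ∫ ρ in (0:ℝ)..1, ρ * h ρ t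
    calc _ = (∫ r in (0:ℝ)..1, r * (h r t - I) ^ 2) +
          ∫ r in (0:ℝ)..1, r * radialDeriv H (r, t) ^ 2 := by
          rw [← integral_add (Continuous.intervalIntegrable (by fun_prop) _ _)
            (Continuous.intervalIntegrable (by fun_prop) _ _)]
          exact integral_congr fun r _ => by
            simp only [(dr r).deriv]
            ring
      _ ≤ 2 * (2 / σ * E t) := by linarith [a_le t]
      _ ≤ 2 * (2 / σ * ((N 0 + K * E 0 + 1) * Real.exp (-c * t))) := by gcongr
      _ = _ := by ring
  · calc _ = ∫ r in (0:ℝ)..1, r * U (r, t) ^ 2 := integral_congr fun r _ => mul_comm _ _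
      _ ≤ 2 / m * E t := v_le t ht
      _ ≤ 2 / m * ((N 0 + K * E 0 + 1) * Real.exp (-c * t)) := by gcongr
      _ = _ := by ring
end
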